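/- arXiv:1507.07604 — 2 statements merged into one kernel-verified Lean document; each statement's English description precedes it below -/
import Mathlib

section
/- Let π: X → B be a Zariski locally trivial fibration of smooth affine varieties with fiber Y admitting a nontrivial locally nilpotent vector field δ, and let α₁, …, α_k be regular functions on B without common zeros with X_i := X \ (α_i ∘ π)^{-1}(0) ≅ B_i × Y, B_i = B \ α_i^{-1}(0). Suppose π is equivariant with respect to actions of a semisimple group S on X and on B, and the ξ_i are locally nilpotent vector fields on X induced by one-parameter unipotent subgroups of S satisfying: (i) ξ_i(ℂ[B]) ⊆ ℂ[B] inducing ξ_i′ on B; (ii) α_i ∈ Ker ξ_i′; (iii) ξ_i′ admits a slice on B_i. Let N be the ℂ[X]-module generated by the ξ_i, and assume (★): for every x ∈ X the subspace of T_xX generated by the values of N at x coincides with the subspace generated by the values of { ξ_j : α_j(x) ≠ 0 }. Then, if X is equipped with a volume form ω, the set d^{-1}(Θ(Lie_alg^ω(X))) contains the ℂ[X]-submodule of (n−2)-forms consisting of all τ = ι_ζ ι_η ω with ζ running over J·N for some nonzero ideal J of ℂ[X] and some nontrivial locally nilpotent vector field η on X with ℂ[B] ⊆ Ker η. -/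
/-!
STATEMENT 15 (Corollary `ap5`): Let π : X → B be a Zariski locally trivial fibration of
smooth affine varieties with fiber Y admitting a nontrivial locally nilpotent vector
field δ, and let α₁, …, α_k be regular functions on B without common zeros with
X_i := X \ (α_i ∘ π)⁻¹(0) ≅ B_i × Y, B_i = B \ α_i⁻¹(0).  Suppose π is equivariant with
respect to actions of a semisimple group S on X and on B, and the ξ_i are locally
nilpotent vector fields on X induced by one-parameter unipotent subgroups of S
satisfying: (i) ξ_i(ℂ[B]) ⊆ ℂ[B] inducing ξ_i′ on B; (ii) α_i ∈ Ker ξ_i′; (iii) ξ_i′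
admits a slice on B_i.  Let N be the ℂ[X]-module generated by the ξ_i, and assume (★):
for every x ∈ X the subspace of T_xX generated by the values of N at x coincides with
the subspace generated by the values of { ξ_j : α_j(x) ≠ 0 }.  Then, if X is equipped
with a volume form ω, the set d⁻¹(Θ(Lie_alg^ω(X))) contains the ℂ[X]-submodule of
(n−2)-forms consisting of all τ = ι_ζ ι_η ω with ζ running over J·N for some nonzero
ideal J of ℂ[X] and some nontrivial locally nilpotent vector field η on X with
ℂ[B] ⊆ Ker η.

Modelling conventions as in the companion files: coordinate rings A, R, CY of X, B, Y;
comorphism πs; local triviality via ring isomorphisms of localizations with tensor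
products over B_i; a slice of ξ_i′ on B_i is encoded (clearing denominators) by r ∈ R
with ξ_i′ r = α_i^m; a semisimple linear algebraic group is a Zariski closed connected
reductive subgroup of some GL_m(ℂ) with finite center; "ξ_i is induced by a
one-parameter unipotent subgroup of S" says that a polynomial homomorphism
c : ℂ₊ → S acts on A by the phase flow exp(t ξ_i); Θ(ξ) = ι_ξ ω and a field is
divergence-free iff d(ι_ξ ω) = 0.
-/

set_option synthInstance.maxHeartbeats 1000000
set_option maxHeartbeats 1000000

noncomputable section

open scoped TensorProduct

def IsCompleteField {A : Type*} [CommRing A] [Algebra ℂ A] (ξ : Derivation ℂ A A) : Prop :=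
  ∀ p : A →ₐ[ℂ] ℂ, ∃ γ : ℂ → (A →ₐ[ℂ] ℂ), γ 0 = p ∧
    ∀ (a : A) (t : ℂ), HasDerivAt (fun s => (γ s) a) ((γ t) (ξ a)) t

def IsLND {A : Type*} [CommRing A] [Algebra ℂ A] (ξ : Derivation ℂ A A) : Prop :=
  ∀ a : A, ∃ N : ℕ, (ξ.toLinearMap ^ N) a = 0

def fieldAt {A : Type*} [CommRing A] [Algebra ℂ A] (p : A →ₐ[ℂ] ℂ)
    (ξ : Derivation ℂ A A) : A →ₗ[ℂ] ℂ :=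
  p.toLinearMap.comp ξ.toLinearMap

abbrev GLn (n : ℕ) := GL (Fin n) ℂ

def glEntries {n : ℕ} (g : GLn n) : Fin n × Fin n → ℂ :=
  fun ij => (g : Matrix (Fin n) (Fin n) ℂ) ij.1 ij.2

def IsZClosedInGL {n : ℕ} (s : Set (GLn n)) : Prop :=
  ∃ P : Set (MvPolynomial (Fin n × Fin n) ℂ),
    ∀ g : GLn n, g ∈ s ↔ ∀ p ∈ P, MvPolynomial.eval (glEntries g) p = 0

def IsRegularOnGL {n : ℕ} (f : GLn n → ℂ) : Prop :=
  ∃ (q : MvPolynomial (Fin n × Fin n) ℂ) (m : ℕ),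
    ∀ g : GLn n, f g * ((g : Matrix (Fin n) (Fin n) ℂ).det) ^ m = MvPolynomial.eval (glEntries g) q

def IsRegularOnSubgroup {n : ℕ} (G : Subgroup (GLn n)) (c : ↥G → ℂ) : Prop :=
  ∃ f : GLn n → ℂ, IsRegularOnGL f ∧ ∀ g : ↥G, c g = f ↑g

structure AlgebraicAction {n : ℕ} (G : Subgroup (GLn n)) (A : Type*) [CommRing A]
    [Algebra ℂ A] where
  act : ↥G →* (A ≃ₐ[ℂ] A)
  regular : ∀ a : A, ∃ (k : ℕ) (b : Fin k → A) (c : Fin k → ↥G → ℂ),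
    (∀ i, IsRegularOnSubgroup G (c i)) ∧
    ∀ g : ↥G, act g a = ∑ i, algebraMap ℂ A (c i g) * b i

def IsUnipotentElt {n : ℕ} (g : GLn n) : Prop :=
  IsNilpotent ((g : Matrix (Fin n) (Fin n) ℂ) - 1)

/-- Reductive: no nontrivial Zariski closed normal unipotent subgroup. -/
def IsReductiveSubgroup {n : ℕ} (S : Subgroup (GLn n)) : Prop :=
  ∀ W : Subgroup (GLn n), W ≤ S → IsZClosedInGL (W : Set (GLn n)) →
    (∀ s ∈ S, ∀ w ∈ W, s * w * s⁻¹ ∈ W) → (∀ w ∈ W, IsUnipotentElt w) → W = ⊥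

/-- Semisimple linear algebraic group: Zariski closed, connected, reductive, with
finite center. -/
def IsSemisimpleGrp {n : ℕ} (S : Subgroup (GLn n)) : Prop :=
  IsZClosedInGL (S : Set (GLn n)) ∧ IsConnected (S : Set (GLn n)) ∧
  IsReductiveSubgroup S ∧ {g : ↥S | ∀ h : ↥S, g * h = h * g}.Finite

/-- Differential-form data for a smooth affine variety `X` of dimension `n` with
coordinate ring `A`: the modules `F0, F1, F2` of algebraic forms of degrees
`n-2, n-1, n`, the exterior differential, the interior products with algebraic vector
fields, a nowhere vanishing top form `vol` (algebraic volume form), and the induced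
action ("pullback") of algebra automorphisms on forms. -/
structure VolumeForms (A : Type*) [CommRing A] [Algebra ℂ A] where
  F0 : Type*
  F1 : Type*
  F2 : Type*
  [acg0 : AddCommGroup F0]
  [acg1 : AddCommGroup F1]
  [acg2 : AddCommGroup F2]
  [modA0 : Module A F0]
  [modA1 : Module A F1]
  [modA2 : Module A F2]
  [modC0 : Module ℂ F0]
  [modC1 : Module ℂ F1]
  [modC2 : Module ℂ F2]
  [tower0 : IsScalarTower ℂ A F0]
  [tower1 : IsScalarTower ℂ A F1]
  [tower2 : IsScalarTower ℂ A F2]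
  /-- exterior differential on (n-2)-forms -/
  d0 : F0 →ₗ[ℂ] F1
  /-- exterior differential on (n-1)-forms -/
  d1 : F1 →ₗ[ℂ] F2
  dd : ∀ τ : F0, d1 (d0 τ) = 0
  /-- interior product of a vector field with an n-form -/
  ι2 : Derivation ℂ A A →ₗ[A] (F2 →ₗ[A] F1)
  /-- interior product of a vector field with an (n-1)-form -/
  ι1 : Derivation ℂ A A →ₗ[A] (F1 →ₗ[A] F0)
  /-- the algebraic volume form -/
  vol : F2
  /-- `vol` is nowhere vanishing: it freely generates the top forms -/
  vol_basis : Function.Bijective fun a : A => a • vol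
  /-- `Θ : ξ ↦ ι_ξ ω` is an isomorphism of vector fields onto (n-1)-forms -/
  theta_bij : Function.Bijective fun ξ : Derivation ℂ A A => ι2 ξ vol
  /-- `ι_{[σ,δ]} ω = d (ι_σ ι_δ ω)` for divergence-free σ, δ -/
  cartan : ∀ σ δ : Derivation ℂ A A, d1 (ι2 σ vol) = 0 → d1 (ι2 δ vol) = 0 →
    ι2 ⁅σ, δ⁆ vol = d0 (ι1 σ (ι2 δ vol))
  /-- functorial action of algebra automorphisms on (n-2)-forms -/
  push0 : (A ≃ₐ[ℂ] A) → (F0 →+ F0)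
  push1 : (A ≃ₐ[ℂ] A) → (F1 →+ F1)
  push2 : (A ≃ₐ[ℂ] A) → (F2 →+ F2)
  push0_smul : ∀ (g : A ≃ₐ[ℂ] A) (a : A) (τ : F0), push0 g (a • τ) = g a • push0 g τ
  push1_smul : ∀ (g : A ≃ₐ[ℂ] A) (a : A) (τ : F1), push1 g (a • τ) = g a • push1 g τ
  push2_smul : ∀ (g : A ≃ₐ[ℂ] A) (a : A) (τ : F2), push2 g (a • τ) = g a • push2 g τ
  push0_one : push0 1 = AddMonoidHom.id F0
  push1_one : push1 1 = AddMonoidHom.id F1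
  push2_one : push2 1 = AddMonoidHom.id F2
  push0_mul : ∀ g h τ, push0 (g * h) τ = push0 g (push0 h τ)
  push1_mul : ∀ g h τ, push1 (g * h) τ = push1 g (push1 h τ)
  push2_mul : ∀ g h τ, push2 (g * h) τ = push2 g (push2 h τ)
  push_d0 : ∀ g τ, d0 (push0 g τ) = push1 g (d0 τ)
  push_d1 : ∀ g τ, d1 (push1 g τ) = push2 g (d1 τ)
  push_ι2 : ∀ (g : A ≃ₐ[ℂ] A) (ξ : Derivation ℂ A A) (τ : F2),
    (∀ a, ξ (g a) = g (ξ a)) → push1 g (ι2 ξ τ) = ι2 ξ (push2 g τ)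
  push_ι1 : ∀ (g : A ≃ₐ[ℂ] A) (ξ : Derivation ℂ A A) (τ : F1),
    (∀ a, ξ (g a) = g (ξ a)) → push0 g (ι1 ξ τ) = ι1 ξ (push1 g τ)

attribute [instance] VolumeForms.acg0 VolumeForms.acg1 VolumeForms.acg2
  VolumeForms.modA0 VolumeForms.modA1 VolumeForms.modA2
  VolumeForms.modC0 VolumeForms.modC1 VolumeForms.modC2
  VolumeForms.tower0 VolumeForms.tower1 VolumeForms.tower2


/-- A vector field is divergence-free (has zero divergence w.r.t. the volume form)
iff `ι_ξ ω` is closed (equivalently `L_ξ ω = d ι_ξ ω = 0`). -/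
def VolumeForms.DivFree {A : Type*} [CommRing A] [Algebra ℂ A] (Ω : VolumeForms A)
    (ξ : Derivation ℂ A A) : Prop :=
  Ω.d1 (Ω.ι2 ξ Ω.vol) = 0

def LieAlgGenOmega {A : Type*} [CommRing A] [Algebra ℂ A] (Ω : VolumeForms A) :
    LieSubalgebra ℂ (Derivation ℂ A A) :=
  LieSubalgebra.lieSpan ℂ (Derivation ℂ A A) {ξ | IsCompleteField ξ ∧ Ω.DivFree ξ}

theorem isLND_iff_iterate {A : Type*} [CommRing A] [Algebra ℂ A] {κ : Derivation ℂ A A} :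
    IsLND κ ↔ ∀ a, ∃ N : ℕ, κ^[N] a = 0 := by
  simp only [IsLND, Module.End.pow_apply]
  rfl

namespace LocallyNilpotent

open Polynomial

variable {A : Type*} [CommRing A] [Algebra ℂ A]

theorem iterate_map_smul (κ : Derivation ℂ A A) (n : ℕ) (z : ℂ) (a : A) :
    κ^[n] (z • a) = z • κ^[n] a :=
  Function.Commute.iterate_left (fun a => κ.map_smul z a) n a

theorem iterate_mul_of_ker (κ : Derivation ℂ A A) {f : A} (hf : κ f = 0) (n : ℕ) (a : A) :
    κ^[n] (f * a) = f * κ^[n] a :=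
  Function.Commute.iterate_left (f := κ) (g := fun a => f * a) (fun a => by simp [hf]) n a

theorem iterate_eq_zero_of_le (κ : Derivation ℂ A A) {m n : ℕ} (h : m ≤ n) {a : A}
    (ha : κ^[m] a = 0) : κ^[n] a = 0 := by
  obtain ⟨d, rfl⟩ := Nat.exists_eq_add_of_le' h
  rw [Function.iterate_add_apply, ha, iterate_map_zero]

theorem ker_mul (κ : Derivation ℂ A A) {f g : A} (hf : κ f = 0) (hg : κ g = 0) :
    κ (f * g) = 0 := by simp [hf, hg]

theorem ker_pow (κ : Derivation ℂ A A) {f : A} (hf : κ f = 0) (n : ℕ) : κ (f ^ n) = 0 := by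
  simp [hf]

theorem isLND_smul {κ : Derivation ℂ A A} (hκ : IsLND κ) {f : A} (hf : κ f = 0) :
    IsLND (f • κ) := by
  rw [isLND_iff_iterate] at hκ ⊢
  have key : ∀ n a, (f • κ)^[n] a = f ^ n * κ^[n] a := by
    intro n
    induction n with
    | zero => simp
    | succ n ih =>
      intro a
      rw [Function.iterate_succ_apply', ih, Function.iterate_succ_apply']
      simp only [Derivation.smul_apply, Derivation.leibniz, ker_pow κ hf n, smul_eq_mul]
      ring
  intro a
  obtain ⟨N, hN⟩ := hκ a
  exact ⟨N, by rw [key, hN, mul_zero]⟩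

/-- The index at which the iterates of a locally nilpotent derivation on `a` vanish. -/
def order (κ : Derivation ℂ A A) (hκ : IsLND κ) (a : A) : ℕ :=
  (isLND_iff_iterate.1 hκ a).choose

/-- The polynomial `∑ κⁿ(a) Xⁿ / n!`. -/
def expPoly (κ : Derivation ℂ A A) (hκ : IsLND κ) (a : A) : A[X] :=
  ∑ n ∈ Finset.range (order κ hκ a), monomial n ((n.factorial : ℂ)⁻¹ • κ^[n] a)

variable (κ : Derivation ℂ A A) (hκ : IsLND κ)

theorem coeff_expPoly (a : A) (n : ℕ) :
    (expPoly κ hκ a).coeff n = (n.factorial : ℂ)⁻¹ • κ^[n] a := by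
  simp only [expPoly, finsetSum_coeff, coeff_monomial, Finset.sum_ite_eq', Finset.mem_range]
  split_ifs with h
  · rfl
  · rw [iterate_eq_zero_of_le κ (not_lt.1 h) (isLND_iff_iterate.1 hκ a).choose_spec, smul_zero]

theorem expPoly_add (a b : A) : expPoly κ hκ (a + b) = expPoly κ hκ a + expPoly κ hκ b := by
  ext n
  simp [coeff_expPoly, iterate_map_add]

theorem derivative_expPoly (a : A) :
    derivative (expPoly κ hκ a) = expPoly κ hκ (κ a) := by
  ext n
  rw [coeff_derivative, coeff_expPoly, coeff_expPoly, Function.iterate_succ_apply, mul_comm,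
    show ((n : A) + 1) = algebraMap ℂ A (n + 1) by simp, ← Algebra.smul_def, smul_smul]
  congr 1
  have : (n : ℂ) + 1 ≠ 0 := Nat.cast_add_one_ne_zero n
  rw [Nat.factorial_succ]
  push_cast
  field_simp

theorem eq_of_coeff_succ {p q : A[X]} {n : ℕ}
    (h : (derivative p).coeff n = (derivative q).coeff n) : p.coeff (n + 1) = q.coeff (n + 1) := by
  rw [coeff_derivative, coeff_derivative,
    show ((n : A) + 1) = algebraMap ℂ A (n + 1) by simp] at h
  have hu : IsUnit (algebraMap ℂ A (n + 1)) :=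
    (isUnit_iff_ne_zero.2 (Nat.cast_add_one_ne_zero n)).map _
  exact hu.mul_left_injective h

theorem expPoly_mul (a b : A) : expPoly κ hκ (a * b) = expPoly κ hκ a * expPoly κ hκ b := by
  ext n
  induction n generalizing a b with
  | zero => simp [coeff_expPoly, mul_coeff_zero]
  | succ n ih =>
    apply eq_of_coeff_succ
    rw [derivative_expPoly, derivative_mul, derivative_expPoly, derivative_expPoly,
      Derivation.leibniz, expPoly_add, coeff_add, coeff_add, smul_eq_mul, smul_eq_mul, ih, ih,
      add_comm, mul_comm (expPoly κ hκ b)]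

theorem expPoly_of_ker {a : A} (ha : κ a = 0) : expPoly κ hκ a = C a := by
  ext n
  rw [coeff_expPoly, coeff_C]
  cases n with
  | zero => simp
  | succ n => simp [Function.iterate_succ_apply, ha, iterate_map_zero]

/-- The homomorphism `a ↦ ∑ tⁿ κⁿ(a) / n!`. -/
def expHom (t : ℂ) : A →ₐ[ℂ] A where
  toFun a := (expPoly κ hκ a).eval (algebraMap ℂ A t)
  map_one' := by rw [expPoly_of_ker κ hκ κ.map_one_eq_zero]; simp
  map_mul' a b := by rw [expPoly_mul, eval_mul]
  map_zero' := by rw [expPoly_of_ker κ hκ κ.map_zero]; simp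
  map_add' a b := by rw [expPoly_add, eval_add]
  commutes' z := by rw [expPoly_of_ker κ hκ (κ.map_algebraMap z)]; simp

theorem expHom_apply (t : ℂ) (a : A) :
    expHom κ hκ t a = (expPoly κ hκ a).eval (algebraMap ℂ A t) := rfl

theorem expHom_eq_sum (t : ℂ) {a : A} {N : ℕ} (hN : κ^[N] a = 0) :
    expHom κ hκ t a = ∑ n ∈ Finset.range N, (t ^ n * (n.factorial : ℂ)⁻¹) • κ^[n] a := by
  have hd : (expPoly κ hκ a).natDegree < N + 1 := by
    rw [Nat.lt_succ_iff, natDegree_le_iff_coeff_eq_zero]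
    intro n hn
    rw [coeff_expPoly, iterate_eq_zero_of_le κ hn.le hN, smul_zero]
  rw [expHom_apply, eval_eq_sum_range' hd, Finset.sum_range_succ, coeff_expPoly, hN, smul_zero,
    zero_mul, add_zero]
  refine Finset.sum_congr rfl fun n _ => ?_
  rw [coeff_expPoly, ← map_pow, mul_comm, ← Algebra.smul_def, smul_smul]

theorem expHom_of_ker (t : ℂ) {a : A} (ha : κ a = 0) : expHom κ hκ t a = a := by
  rw [expHom_apply, expPoly_of_ker κ hκ ha, eval_C]

theorem expHom_of_slice (t : ℂ) {s : A} (hs : κ (κ s) = 0) :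
    expHom κ hκ t s = s + t • κ s := by
  rw [expHom_eq_sum κ hκ t (N := 2) hs]
  simp [Finset.sum_range_succ]

theorem commute_expHom (t : ℂ) {v : Derivation ℂ A A} (hv : ∀ a, κ (v a) = v (κ a)) (a : A) :
    v (expHom κ hκ t a) = expHom κ hκ t (v a) := by
  obtain ⟨N, hN⟩ := isLND_iff_iterate.1 hκ a
  have hit : ∀ n, κ^[n] (v a) = v (κ^[n] a) := fun n =>
    Function.Commute.iterate_left (f := κ) (g := v) hv n a
  rw [expHom_eq_sum κ hκ t hN, expHom_eq_sum κ hκ t (N := N) (by rw [hit, hN, map_zero]),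
    map_sum]
  simp [hit]

theorem taylor_expPoly (t : ℂ) (a : A) :
    taylor (algebraMap ℂ A t) (expPoly κ hκ a) = expPoly κ hκ (expHom κ hκ t a) := by
  ext n
  induction n generalizing a with
  | zero => rw [taylor_coeff_zero, coeff_expPoly]; simp [expHom_apply]
  | succ n ih =>
    apply eq_of_coeff_succ
    rw [derivative_expPoly, commute_expHom κ hκ t (fun _ => rfl), ← ih, ← derivative_expPoly]
    congr 1
    simp [taylor_apply, derivative_comp]

theorem expHom_add (s t : ℂ) (a : A) :
    expHom κ hκ (s + t) a = expHom κ hκ s (expHom κ hκ t a) := by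
  rw [expHom_apply κ hκ s, ← taylor_expPoly, taylor_eval, ← map_add]
  rfl

theorem expHom_zero (a : A) : expHom κ hκ 0 a = a := by
  rw [expHom_apply, map_zero, ← coeff_zero_eq_eval_zero, coeff_expPoly]
  simp

/-- The automorphism `exp (t κ)`. -/
def expEquiv (t : ℂ) : A ≃ₐ[ℂ] A :=
  AlgEquiv.ofAlgHom (expHom κ hκ t) (expHom κ hκ (-t))
    (by ext a; simp [← expHom_add, expHom_zero])
    (by ext a; simp [← expHom_add, expHom_zero])

theorem expEquiv_apply (t : ℂ) (a : A) : expEquiv κ hκ t a = expHom κ hκ t a := rfl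

theorem expEquiv_add (s t : ℂ) : expEquiv κ hκ (s + t) = expEquiv κ hκ s * expEquiv κ hκ t := by
  ext a
  exact expHom_add κ hκ s t a

include hκ in
theorem ker_of_expHom_eq {a : A} (ha : expHom κ hκ 1 a = a) : κ a = 0 := by
  classical
  obtain ⟨N, hN⟩ := isLND_iff_iterate.1 hκ a
  have key : ∀ n, κ^[n + 1] a = 0 → κ^[1] a = 0 := by
    intro n
    induction n with
    | zero => exact id
    | succ n ih =>
      intro h
      apply ih
      have h1 := commute_expHom κ hκ 1 (v := κ) (fun _ => rfl)
      have h2 : expHom κ hκ 1 (κ^[n] a) = κ^[n] a := by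
        rw [← Function.Commute.iterate_left (f := κ) (g := expHom κ hκ 1) h1 n a, ha]
      have h3 : κ (κ (κ^[n] a)) = 0 := by
        rw [← Function.iterate_succ_apply' κ, ← Function.iterate_succ_apply' κ]; exact h
      rw [expHom_of_slice κ hκ 1 h3, one_smul, add_eq_left] at h2
      rw [Function.iterate_succ_apply', h2]
  exact key N (iterate_eq_zero_of_le κ (Nat.le_succ N) hN)

include hκ in
theorem ker_of_isUnit [IsDomain A] {u : A} (hu : IsUnit u) : κ u = 0 := by
  obtain ⟨v, hv⟩ := hu.exists_right_inv
  have h : expPoly κ hκ u * expPoly κ hκ v = 1 := by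
    rw [← expPoly_mul, hv, expPoly_of_ker κ hκ κ.map_one_eq_zero, C_1]
  have h2 := natDegree_eq_zero_of_isUnit (IsUnit.of_mul_eq_one _ h)
  have h3 := coeff_eq_zero_of_natDegree_lt (h2.trans_lt Nat.one_pos)
  rw [coeff_expPoly] at h3
  simpa using h3

include hκ in
theorem isCompleteField : IsCompleteField κ := by
  intro p
  refine ⟨fun t => p.comp (expHom κ hκ t), ?_, fun a t => ?_⟩
  · ext a
    simp [expHom_zero]
  · have hpoly : ∀ b s, p (expHom κ hκ s b) = ((expPoly κ hκ b).map p.toRingHom).eval s := by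
      intro b s
      have h := Polynomial.eval_map_apply (f := p.toRingHom) (p := expPoly κ hκ b)
        (algebraMap ℂ A s)
      simp only [AlgHom.toRingHom_eq_coe, RingHom.coe_coe, AlgHom.commutes] at h
      exact h.symm
    have h := ((expPoly κ hκ a).map p.toRingHom).hasDerivAt t
    rw [derivative_map, derivative_expPoly] at h
    simpa [hpoly] using h

end LocallyNilpotent

open Polynomial in
theorem mem_range_algebraMap_of_forall_pow {K : Type*} [Field K] [Algebra ℂ K]
    [Algebra.EssFiniteType ℂ K] {u : K} (hu : ∀ n : ℕ, 0 < n → ∃ v, v ^ n = u) :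
    u ∈ (algebraMap ℂ K).range := by
  by_contra hmem
  have htr : Transcendental ℂ u := by
    intro halg
    exact hmem (minpoly.mem_range_of_degree_eq_one ℂ u
      (IsAlgClosed.degree_eq_one_of_irreducible ℂ (minpoly.irreducible halg.isIntegral)))
  have hind : AlgebraicIndepOn ℂ id ({u} : Set K) :=
    (algebraicIndependent_singleton_iff (⟨u, rfl⟩ : ({u} : Set K))).2 htr
  obtain ⟨S, huS, hS⟩ := exists_isTranscendenceBasis_superset hind
  have hfield := hS.isAlgebraic_field
  let E := IntermediateField.adjoin ℂ (Set.range ((↑) : S → K))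
  have : Algebra.EssFiniteType E K := Algebra.EssFiniteType.of_comp ℂ E K
  have hfin : Module.Finite E K := Algebra.finite_of_essFiniteType_of_isAlgebraic
  let s : S := ⟨u, huS rfl⟩
  let φ := hS.1.aevalEquivField
  let a : E := φ (algebraMap (MvPolynomial S ℂ) _ (MvPolynomial.X s))
  have ha : (a : K) = u := by
    simp only [a, φ]
    rw [AlgebraicIndependent.aevalEquivField_algebraMap_apply_coe, MvPolynomial.aeval_X]
  obtain ⟨p, hp, hprime⟩ := Nat.exists_infinite_primes (Module.finrank E K + 1)
  have hirr : Irreducible (X ^ p - C a) := by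
    apply X_pow_sub_C_irreducible_of_prime hprime
    intro b hb
    have hb' : (φ.symm b) ^ p =
        algebraMap (MvPolynomial S ℂ) (FractionRing (MvPolynomial S ℂ)) (MvPolynomial.X s) := by
      rw [← map_pow, hb, AlgEquiv.symm_apply_apply]
    obtain ⟨y, hy⟩ := IsIntegrallyClosed.exists_algebraMap_eq_of_isIntegral_pow
      (R := MvPolynomial S ℂ) hprime.pos
      (x := φ.symm b) (by rw [hb']; exact isIntegral_algebraMap)
    rw [← hy, ← map_pow] at hb'
    have hX := IsFractionRing.injective _ (FractionRing (MvPolynomial S ℂ)) hb'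
    apply_fun fun q => (MvPolynomial.aeval (fun _ => (X : ℂ[X])) q).natDegree at hX
    simp only [map_pow, natDegree_pow, MvPolynomial.aeval_X, natDegree_X] at hX
    exact hprime.ne_one (Nat.eq_one_of_mul_eq_one_right hX)
  obtain ⟨v, hv⟩ := hu p hprime.pos
  have hmin := minpoly.eq_of_irreducible_of_monic hirr (x := v)
    (by rw [map_sub, map_pow, aeval_X, aeval_C, hv, sub_eq_zero, ← ha]; rfl)
    (monic_X_pow_sub_C a hprime.ne_zero)
  have hdeg := minpoly.natDegree_le (A := E) v
  rw [← hmin, natDegree_X_pow_sub_C] at hdeg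
  omega

theorem exists_algebraMap_eq_of_forall_pow {A : Type*} [CommRing A] [IsDomain A] [Algebra ℂ A]
    [Algebra.FiniteType ℂ A] {u : A} (hu : ∀ n : ℕ, 0 < n → ∃ v, v ^ n = u) :
    ∃ z : ℂ, algebraMap ℂ A z = u := by
  have : Algebra.EssFiniteType ℂ (FractionRing A) :=
    inferInstanceAs (Algebra.EssFiniteType ℂ (Localization (nonZeroDivisors A)))
  obtain ⟨z, hz⟩ := mem_range_algebraMap_of_forall_pow (K := FractionRing A)
    (u := algebraMap A _ u) fun n hn => by
      obtain ⟨v, hv⟩ := hu n hn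
      exact ⟨algebraMap A _ v, by rw [← map_pow, hv]⟩
  refine ⟨z, IsFractionRing.injective A (FractionRing A) ?_⟩
  rw [← hz, ← IsScalarTower.algebraMap_apply]

namespace LocallyNilpotent

variable {A : Type*} [CommRing A] [Algebra ℂ A]

theorem iterate_pow_slice (κ : Derivation ℂ A A) {s c : A} (hs : κ s = c) (hc : κ c = 0) (n : ℕ) :
    κ^[n] (s ^ n) = (n.factorial : ℂ) • c ^ n := by
  induction n with
  | zero => simp
  | succ n ih =>
    have h : κ (s ^ (n + 1)) = ((n : ℂ) + 1) • (c * s ^ n) := by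
      rw [Derivation.leibniz_pow, hs, Nat.add_sub_cancel, smul_eq_mul, mul_comm c,
        ← Nat.cast_smul_eq_nsmul ℂ]
      push_cast
      rfl
    rw [Function.iterate_succ_apply, h, iterate_map_smul, iterate_mul_of_ker κ hc, ih,
      mul_smul_comm, smul_smul, pow_succ', Nat.factorial_succ]
    push_cast
    rfl

theorem exists_pow_mul_mem_span {κ : Derivation ℂ A A} (hκ : IsLND κ) {s c : A} (hs : κ s = c)
    (hc : κ c = 0) (a : A) :
    ∃ M : ℕ, c ^ M * a ∈ Submodule.span ℂ {x | ∃ f k, κ f = 0 ∧ x = f * s ^ k} := by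
  obtain ⟨N, hN⟩ := isLND_iff_iterate.1 hκ a
  induction N generalizing a with
  | zero =>
    rw [Function.iterate_zero, id_eq] at hN
    exact ⟨0, by simp [hN]⟩
  | succ N ih =>
    have hf : κ (κ^[N] a) = 0 := by rw [← Function.iterate_succ_apply' κ]; exact hN
    have hfac : (N.factorial : ℂ) ≠ 0 := Nat.cast_ne_zero.2 N.factorial_ne_zero
    have h0 : κ^[N] (c ^ N * a + (-(N.factorial : ℂ)⁻¹) • (κ^[N] a * s ^ N)) = 0 := by
      rw [iterate_map_add, iterate_map_smul, iterate_mul_of_ker κ (ker_pow κ hc N),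
        iterate_mul_of_ker κ hf, iterate_pow_slice κ hs hc, mul_smul_comm, smul_smul,
        neg_mul, inv_mul_cancel₀ hfac]
      simp [mul_comm]
    obtain ⟨M, hM⟩ := ih _ h0
    refine ⟨M + N, ?_⟩
    have h1 : c ^ M * κ^[N] a * s ^ N ∈
        Submodule.span ℂ {x | ∃ f k, κ f = 0 ∧ x = f * s ^ k} :=
      Submodule.subset_span ⟨_, N, ker_mul κ (ker_pow κ hc M) hf, rfl⟩
    have h2 := Submodule.add_mem _ hM (Submodule.smul_mem _ ((N.factorial : ℂ)⁻¹) h1)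
    convert h2 using 1
    simp only [mul_add, neg_smul, mul_neg, mul_smul_comm, pow_add, mul_assoc,
      neg_add_cancel_right]

theorem smul_eq_of_ker_le [IsDomain A] {κ : Derivation ℂ A A} (hκ : IsLND κ) {s c : A}
    (hs : κ s = c) (hc : κ c = 0) (hc0 : c ≠ 0) {Δ : Derivation ℂ A A}
    (hΔ : ∀ f, κ f = 0 → Δ f = 0) : c • Δ = Δ s • κ := by
  have key : ∀ x ∈ Submodule.span ℂ {x | ∃ f k, κ f = 0 ∧ x = f * s ^ k},
      (c • Δ) x = (Δ s • κ) x := by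
    intro x hx
    induction hx using Submodule.span_induction with
    | mem x hx =>
      obtain ⟨f, k, hf, rfl⟩ := hx
      simp only [Derivation.smul_apply, Derivation.leibniz, Derivation.leibniz_pow, hf, hΔ f hf, hs,
        smul_eq_mul, nsmul_eq_mul]
      ring
    | zero => simp
    | add x y _ _ hx hy => rw [map_add, map_add, hx, hy]
    | smul z x _ hx => rw [Derivation.map_smul, Derivation.map_smul, hx]
  ext a
  obtain ⟨M, hM⟩ := exists_pow_mul_mem_span hκ hs hc a
  have h := key _ hM
  simp only [Derivation.smul_apply, Derivation.leibniz, ker_pow κ hc, hΔ _ (ker_pow κ hc M),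
    smul_eq_mul, mul_zero, add_zero] at h
  apply mul_left_cancel₀ (pow_ne_zero M hc0)
  simp only [Derivation.smul_apply, smul_eq_mul]
  linear_combination h

theorem exists_ker_apply_ne_zero {A : Type*} [CommRing A] [Algebra ℂ A] [IsDomain A]
    {κ E : Derivation ℂ A A} (hκ : IsLND κ) {s c : A} (hs : κ s = c) (hc : κ c = 0) (hc0 : c ≠ 0)
    (hEs : E s = 0) (hE : E ≠ 0) : ∃ f, κ f = 0 ∧ E f ≠ 0 := by
  by_contra! hcon
  apply hE
  have h := smul_eq_of_ker_le hκ hs hc hc0 hcon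
  rw [hEs, zero_smul] at h
  ext a
  have ha := congrArg (fun D : Derivation ℂ A A => D a) h
  exact (mul_eq_zero.1 ha).resolve_left hc0

theorem exists_slice {κ : Derivation ℂ A A} (hκ : IsLND κ) (h0 : κ ≠ 0) :
    ∃ s, κ s ≠ 0 ∧ κ (κ s) = 0 := by
  classical
  obtain ⟨a, ha⟩ : ∃ a, κ a ≠ 0 := by
    by_contra! h
    exact h0 (Derivation.ext h)
  have hex := isLND_iff_iterate.1 hκ a
  obtain ⟨n, hn⟩ : ∃ n, Nat.find hex = n + 2 := by
    refine ⟨Nat.find hex - 2, ?_⟩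
    have : 2 ≤ Nat.find hex := by
      rw [Nat.le_find_iff]
      intro m hm hm'
      exact ha (iterate_eq_zero_of_le κ (n := 1) (by omega) hm')
    omega
  refine ⟨κ^[n] a, ?_, ?_⟩
  · rw [← Function.iterate_succ_apply' κ]
    exact Nat.find_min hex (by omega)
  · rw [← Function.iterate_succ_apply' κ, ← Function.iterate_succ_apply' κ]
    have := Nat.find_spec hex
    rwa [hn] at this

section Commutator

variable (κ μ : Derivation ℂ A A)

/-- The iterated commutator `(ad κ)ⁿ μ`. -/
def adIter (n : ℕ) : Derivation ℂ A A := (fun ν => ⁅κ, ν⁆)^[n] μ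

theorem adIter_succ (n : ℕ) : adIter κ μ (n + 1) = ⁅κ, adIter κ μ n⁆ :=
  Function.iterate_succ_apply' _ _ _

theorem adIter_succ_apply (n : ℕ) (a : A) :
    adIter κ μ (n + 1) a = κ (adIter κ μ n a) - adIter κ μ n (κ a) := by
  rw [adIter_succ, Derivation.commutator_apply]

theorem adIter_apply_of_ker {f : A} (hf : κ f = 0) (n : ℕ) : adIter κ μ n f = κ^[n] (μ f) := by
  induction n with
  | zero => rfl
  | succ n ih => rw [adIter_succ_apply, hf, map_zero, sub_zero, ih, Function.iterate_succ_apply']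

theorem adIter_sub (ν : Derivation ℂ A A) (n : ℕ) :
    adIter κ (μ - ν) n = adIter κ μ n - adIter κ ν n := by
  induction n with
  | zero => rfl
  | succ n ih => rw [adIter_succ, ih, lie_sub, ← adIter_succ, ← adIter_succ]

theorem adIter_smul_of_ker {f : A} (hf : κ f = 0) (n : ℕ) :
    adIter κ (f • μ) n = f • adIter κ μ n := by
  induction n with
  | zero => rfl
  | succ n ih =>
    rw [adIter_succ, ih, adIter_succ]
    ext a
    simp [Derivation.commutator_apply, hf, mul_sub]

theorem adIter_smul_of_commute (h : ⁅κ, μ⁆ = 0) (g : A) (n : ℕ) :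
    adIter κ (g • μ) n = κ^[n] g • μ := by
  induction n with
  | zero => rfl
  | succ n ih =>
    rw [adIter_succ, ih, Function.iterate_succ_apply']
    ext a
    have ha := congrArg (fun D : Derivation ℂ A A => D a) h
    simp only [Derivation.commutator_apply, Derivation.zero_apply] at ha
    simp only [Derivation.commutator_apply, Derivation.smul_apply, Derivation.leibniz, smul_eq_mul]
    linear_combination (κ^[n] g) * ha

theorem exists_adIter_apply_eq_zero (hκ : IsLND κ) (a : A) : ∃ n₀, ∀ n ≥ n₀, adIter κ μ n a = 0 := by
  obtain ⟨m, hm⟩ := isLND_iff_iterate.1 hκ a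
  induction m generalizing a with
  | zero =>
    rw [Function.iterate_zero, id_eq] at hm
    exact ⟨0, by simp [hm]⟩
  | succ m ih =>
    obtain ⟨n₀, hn₀⟩ := ih (κ a) hm
    obtain ⟨N, hN⟩ := isLND_iff_iterate.1 hκ (adIter κ μ n₀ a)
    have hit : ∀ k, adIter κ μ (n₀ + k) a = κ^[k] (adIter κ μ n₀ a) := by
      intro k
      induction k with
      | zero => rfl
      | succ k ihk =>
        rw [← add_assoc, adIter_succ_apply, hn₀ _ (Nat.le_add_right _ _), sub_zero, ihk,
          Function.iterate_succ_apply']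
    refine ⟨n₀ + N, fun n hn => ?_⟩
    obtain ⟨d, rfl⟩ := Nat.exists_eq_add_of_le hn
    rw [add_assoc, hit, iterate_eq_zero_of_le κ (Nat.le_add_right _ _) hN]

theorem exists_adIter_eq_zero [Algebra.FiniteType ℂ A] (hκ : IsLND κ) : ∃ n, adIter κ μ n = 0 := by
  obtain ⟨S, hS⟩ := (Algebra.FiniteType.out : (⊤ : Subalgebra ℂ A).FG)
  choose N hN using exists_adIter_apply_eq_zero κ μ hκ
  refine ⟨S.sup N, Derivation.ext_of_adjoin_eq_top _ hS fun a ha => ?_⟩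
  exact hN a _ (Finset.le_sup ha)

theorem exists_commute_of_adIter_eq_zero {s c : A} (hs : κ s = c) (hc : κ c = 0) {n : ℕ}
    (hn : adIter κ μ n = 0) :
    ∃ (w : Derivation ℂ A A) (M : ℕ), ⁅κ, w⁆ = 0 ∧
      ∀ f, κ f = 0 → κ (μ f) = 0 → w f = c ^ M * μ f := by
  induction n generalizing μ with
  | zero =>
    have hn : μ = 0 := hn
    exact ⟨0, 0, by simp, fun f _ _ => by simp [hn]⟩
  | succ n ih =>
    rcases n.eq_zero_or_pos with rfl | hpos
    · exact ⟨μ, 0, hn, fun f _ _ => by simp⟩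
    have hfac : (n.factorial : ℂ) ≠ 0 := Nat.cast_ne_zero.2 n.factorial_ne_zero
    rw [adIter_succ] at hn
    obtain ⟨w, M, hw, hwf⟩ := ih (c ^ n • μ - ((n.factorial : ℂ)⁻¹ • s ^ n) • adIter κ μ n) (by
      rw [adIter_sub, adIter_smul_of_ker κ μ (ker_pow κ hc n), adIter_smul_of_commute κ _ hn,
        iterate_map_smul, iterate_pow_slice κ hs hc, smul_smul, inv_mul_cancel₀ hfac, one_smul,
        sub_self])
    refine ⟨w, M + n, hw, fun f hf hμf => ?_⟩
    have h0 : adIter κ μ n f = 0 := by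
      rw [adIter_apply_of_ker κ μ hf]
      exact iterate_eq_zero_of_le κ (m := 1) hpos hμf
    rw [hwf f hf (by simp [h0, hμf, hc])]
    simp [h0, pow_add, mul_assoc]

theorem exists_commute [IsDomain A] [Algebra.FiniteType ℂ A] (hκ : IsLND κ) {s c : A}
    (hs : κ s = c) (hc : κ c = 0) (hc0 : c ≠ 0) {f : A} (hf : κ f = 0) (hμ : μ f ≠ 0) :
    ∃ w : Derivation ℂ A A, ⁅κ, w⁆ = 0 ∧ w f ≠ 0 := by
  classical
  have hex := isLND_iff_iterate.1 hκ (μ f)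
  obtain ⟨e, he⟩ : ∃ e, Nat.find hex = e + 1 :=
    Nat.exists_eq_succ_of_ne_zero fun h => hμ (by simpa [h] using Nat.find_spec hex)
  have h1 : κ^[e] (μ f) ≠ 0 := Nat.find_min hex (by omega)
  have h2 : κ (κ^[e] (μ f)) = 0 := by
    rw [← Function.iterate_succ_apply' κ]
    have := Nat.find_spec hex
    rwa [he] at this
  rw [← adIter_apply_of_ker κ μ hf] at h1 h2
  obtain ⟨n, hn⟩ := exists_adIter_eq_zero κ (adIter κ μ e) hκ
  obtain ⟨w, M, hw, hwf⟩ := exists_commute_of_adIter_eq_zero κ (adIter κ μ e) hs hc hn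
  refine ⟨w, hw, ?_⟩
  rw [hwf f hf h2]
  exact mul_ne_zero (pow_ne_zero M hc0) h1

end Commutator

end LocallyNilpotent

namespace VolumeForms

open LocallyNilpotent

variable {A : Type*} [CommRing A] [IsDomain A] [Algebra ℂ A] (Ω : VolumeForms A)

omit [IsDomain A] in
theorem smul_vol_injective {a b : A} (h : a • Ω.vol = b • Ω.vol) : a = b := Ω.vol_basis.1 h

theorem smul_left_cancel₁ {c : A} (hc : c ≠ 0) {x y : Ω.F1} (h : c • x = c • y) : x = y := by
  obtain ⟨ξ, rfl⟩ := Ω.theta_bij.2 x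
  obtain ⟨ζ, rfl⟩ := Ω.theta_bij.2 y
  have h' : c • ξ = c • ζ := Ω.theta_bij.1 (by simpa using h)
  have : ξ = ζ := by
    ext a
    have ha := congrArg (fun D : Derivation ℂ A A => D a) h'
    exact mul_left_cancel₀ hc ha
  rw [this]

omit [IsDomain A] in
theorem exists_push2_vol (g : A ≃ₐ[ℂ] A) : ∃ u : A, IsUnit u ∧ Ω.push2 g Ω.vol = u • Ω.vol := by
  obtain ⟨u, hu⟩ := Ω.vol_basis.2 (Ω.push2 g Ω.vol)
  obtain ⟨v, hv⟩ := Ω.vol_basis.2 (Ω.push2 g⁻¹ Ω.vol)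
  refine ⟨u, ?_, hu.symm⟩
  have h := Ω.push2_mul g g⁻¹ Ω.vol
  rw [mul_inv_cancel, Ω.push2_one, ← hv] at h
  simp only [AddMonoidHom.id_apply] at h
  rw [Ω.push2_smul, ← hu, smul_smul] at h
  refine IsUnit.of_mul_eq_one (g v) (Ω.smul_vol_injective ?_)
  rw [one_smul, mul_comm]
  exact h.symm

theorem exists_push2_expEquiv [Algebra.FiniteType ℂ A] {κ : Derivation ℂ A A} (hκ : IsLND κ) :
    ∃ z : ℂ, z ≠ 0 ∧ Ω.push2 (expEquiv κ hκ 1) Ω.vol = algebraMap ℂ A z • Ω.vol := by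
  choose u hunit hu using fun t : ℂ => Ω.exists_push2_vol (expEquiv κ hκ t)
  have hadd : ∀ s t, u (s + t) = u s * u t := by
    intro s t
    have h := Ω.push2_mul (expEquiv κ hκ s) (expEquiv κ hκ t) Ω.vol
    rw [← expEquiv_add, hu, hu, Ω.push2_smul, hu, smul_smul, expEquiv_apply,
      expHom_of_ker κ hκ s (ker_of_isUnit κ hκ (hunit t)), mul_comm] at h
    exact Ω.smul_vol_injective h
  have hzero : u 0 = 1 := by
    have h := hadd 0 0
    rw [add_zero] at h
    exact (mul_eq_left₀ (hunit 0).ne_zero).1 h.symm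
  have hmul : ∀ (n : ℕ) (t : ℂ), u (n * t) = u t ^ n := by
    intro n t
    induction n with
    | zero => simp [hzero]
    | succ n ih => rw [Nat.cast_succ, add_mul, one_mul, hadd, ih, pow_succ]
  obtain ⟨z, hz⟩ := exists_algebraMap_eq_of_forall_pow (u := u 1) fun n hn => by
    refine ⟨u (n : ℂ)⁻¹, ?_⟩
    rw [← hmul, mul_inv_cancel₀ (Nat.cast_ne_zero.2 hn.ne')]
  refine ⟨z, ?_, by rw [hz, hu]⟩
  rintro rfl
  exact (hunit 1).ne_zero (by rw [← hz, map_zero])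

omit [IsDomain A] in
theorem commute_of_lie_eq_zero {κ w : Derivation ℂ A A} (h : ⁅κ, w⁆ = 0) (a : A) :
    κ (w a) = w (κ a) := by
  have ha := congrArg (fun D : Derivation ℂ A A => D a) h
  simpa [Derivation.commutator_apply, sub_eq_zero] using ha

theorem expHom_divergence [Algebra.FiniteType ℂ A] {κ : Derivation ℂ A A} (hκ : IsLND κ) {s c : A}
    (hs : κ s = c) (hc : κ c = 0) (hc0 : c ≠ 0) {w : Derivation ℂ A A} (hw : ⁅κ, w⁆ = 0) {f : A}
    (hf : κ f = 0) (hf0 : f ≠ 0) {H G : A} (hH : Ω.d1 (Ω.ι2 w Ω.vol) = H • Ω.vol)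
    (hG : Ω.d1 (Ω.ι2 (w f • κ) Ω.vol) = G • Ω.vol) :
    expHom (f • κ) (isLND_smul hκ hf) 1 H = H - G := by
  have hcomm := commute_of_lie_eq_zero hw
  have hfκ := isLND_smul hκ hf
  set g := expEquiv (f • κ) hfκ 1
  have hker : ∀ a, κ a = 0 → g a = a := fun a ha =>
    expHom_of_ker _ hfκ 1 (by simp [ha])
  have hwf : κ (w f) = 0 := by rw [hcomm, hf, map_zero]
  have hgs : g s = s + f * c := by
    have := expHom_of_slice (f • κ) hfκ 1 (s := s) (by simp [hs, hc, hf])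
    rw [Derivation.smul_apply, hs, smul_eq_mul, one_smul] at this
    exact this
  obtain ⟨z, hz0, hz⟩ := Ω.exists_push2_expEquiv hfκ
  have hκg : Ω.push1 g (Ω.ι2 κ Ω.vol) = algebraMap ℂ A z • Ω.ι2 κ Ω.vol := by
    rw [Ω.push_ι2 g κ _ (commute_expHom (f • κ) hfκ 1 fun a => by simp [hf]), hz, map_smul]
  have hvg : Ω.push1 g (Ω.ι2 ((c * f) • w + (s * w f) • κ) Ω.vol) =
      algebraMap ℂ A z • Ω.ι2 ((c * f) • w + (s * w f) • κ) Ω.vol := by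
    rw [Ω.push_ι2 g _ _ (commute_expHom (f • κ) hfκ 1 fun a => ?_), hz, map_smul]
    simp only [Derivation.add_apply, Derivation.smul_apply, smul_eq_mul, map_add,
      Derivation.leibniz, hc, hf, hs, hwf, hcomm]
    ring
  have hP : Ω.push1 g (Ω.ι2 w Ω.vol) = z • (Ω.ι2 w Ω.vol - Ω.ι2 (w f • κ) Ω.vol) := by
    apply Ω.smul_left_cancel₁ (mul_ne_zero hc0 hf0)
    simp only [map_add, map_smul, LinearMap.add_apply, LinearMap.smul_apply, Ω.push1_smul, map_mul,
      hker c hc, hker f hf, hker _ hwf, hgs, hκg] at hvg ⊢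
    rw [← algebraMap_smul A z]
    linear_combination (norm := module) hvg
  have h := congrArg Ω.d1 hP
  rw [Ω.push_d1, hH, Ω.push2_smul, hz, map_smul, map_sub, hH, hG, ← sub_smul,
    ← algebraMap_smul A z, smul_smul, smul_smul, mul_comm] at h
  exact mul_left_cancel₀ (by simpa using hz0) (Ω.smul_vol_injective h)

theorem divFree_smul_of_commute [Algebra.FiniteType ℂ A] {κ : Derivation ℂ A A} (hκ : IsLND κ)
    {s c : A} (hs : κ s = c) (hc : κ c = 0) (hc0 : c ≠ 0) {w : Derivation ℂ A A}
    (hw : ⁅κ, w⁆ = 0) {f : A} (hf : κ f = 0) : Ω.DivFree (w f • κ) := by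
  rcases eq_or_ne f 0 with rfl | hf0
  · simp [DivFree]
  obtain ⟨H, hH⟩ := Ω.vol_basis.2 (Ω.d1 (Ω.ι2 w Ω.vol))
  obtain ⟨G, hG⟩ := Ω.vol_basis.2 (Ω.d1 (Ω.ι2 (w f • κ) Ω.vol))
  have h1 := Ω.expHom_divergence hκ hs hc hc0 hw κ.map_one_eq_zero one_ne_zero hH.symm (G := 0)
    (by simp)
  have hκH : κ H = 0 := by
    have := ker_of_expHom_eq _ _ (h1.trans (sub_zero H))
    simpa using this
  have h2 := Ω.expHom_divergence hκ hs hc hc0 hw hf hf0 hH.symm hG.symm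
  rw [expHom_of_ker _ _ _ (by simp [hκH])] at h2
  have hG0 : G = 0 := by linear_combination h2
  rw [DivFree, ← hG]
  simp [hG0]

theorem exists_forall_ker_divFree [Algebra.FiniteType ℂ A] {κ : Derivation ℂ A A} (hκ : IsLND κ)
    {s c : A} (hs : κ s = c) (hc : κ c = 0) (hc0 : c ≠ 0) (μ : Derivation ℂ A A) {f : A}
    (hf : κ f = 0) (hμ : μ f ≠ 0) :
    ∃ b, b ≠ 0 ∧ κ b = 0 ∧ ∀ h, κ h = 0 → Ω.DivFree (h • b • κ) := by
  obtain ⟨w, hw, hwf⟩ := exists_commute κ μ hκ hs hc hc0 hf hμ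
  have hcomm := commute_of_lie_eq_zero hw
  refine ⟨w f, hwf, by rw [hcomm, hf, map_zero], fun h hh => ?_⟩
  have hlie : ⁅κ, h • w⁆ = 0 := by
    ext a
    simp [Derivation.commutator_apply, hh, hcomm]
  have := Ω.divFree_smul_of_commute hκ hs hc hc0 hlie hf
  rwa [Derivation.smul_apply, smul_eq_mul, mul_smul] at this

end VolumeForms

namespace VolumeForms

open LocallyNilpotent

section Potentials

variable {A : Type*} [CommRing A] [Algebra ℂ A] (Ω : VolumeForms A)

theorem divFree_of_mem {ν : Derivation ℂ A A} (hν : ν ∈ LieAlgGenOmega Ω) : Ω.DivFree ν := by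
  let K : LieSubalgebra ℂ (Derivation ℂ A A) :=
    { carrier := {ν | Ω.DivFree ν}
      add_mem' := fun {a b} (ha : _ = _) (hb : _ = _) => by
        simp only [Set.mem_ofPred_eq, DivFree, map_add, LinearMap.add_apply, ha, hb, add_zero]
      zero_mem' := by simp [DivFree]
      smul_mem' := fun z a (ha : _ = _) => by
        simp only [Set.mem_ofPred_eq, DivFree]
        rw [← algebraMap_smul A z, map_smul, LinearMap.smul_apply, algebraMap_smul, map_smul, ha,
          smul_zero]
      lie_mem' := fun {a b} (ha : Ω.DivFree a) (hb : Ω.DivFree b) => by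
        simp only [Set.mem_ofPred_eq, DivFree]
        rw [Ω.cartan a b ha hb, Ω.dd] }
  exact (LieSubalgebra.lieSpan_le (K := K)).2 (fun ν hν => hν.2) hν

/-- The `(n-2)`-forms whose differential is `Θ` of an element of `Lie_alg^ω`. -/
def potentials : Submodule ℂ Ω.F0 where
  carrier := {τ | ∃ ν ∈ LieAlgGenOmega Ω, Ω.ι2 ν Ω.vol = Ω.d0 τ}
  add_mem' := by
    rintro _ _ ⟨ν, hν, h⟩ ⟨ν', hν', h'⟩
    exact ⟨ν + ν', add_mem hν hν', by simp [h, h']⟩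
  zero_mem' := ⟨0, zero_mem _, by simp⟩
  smul_mem' := by
    rintro z _ ⟨ν, hν, h⟩
    refine ⟨z • ν, (LieAlgGenOmega Ω).smul_mem z hν, ?_⟩
    rw [← algebraMap_smul A z, map_smul, LinearMap.smul_apply, algebraMap_smul, map_smul, h]

/-- The `(n-2)`-form `ι_σ ι_δ ω`. -/
def contract (σ δ : Derivation ℂ A A) : Ω.F0 := Ω.ι1 σ (Ω.ι2 δ Ω.vol)

theorem contract_smul_left (a : A) (σ δ : Derivation ℂ A A) :
    Ω.contract (a • σ) δ = a • Ω.contract σ δ := by simp [contract]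

theorem contract_smul_right (a : A) (σ δ : Derivation ℂ A A) :
    Ω.contract σ (a • δ) = a • Ω.contract σ δ := by simp [contract]

theorem contract_add_left (σ σ' δ : Derivation ℂ A A) :
    Ω.contract (σ + σ') δ = Ω.contract σ δ + Ω.contract σ' δ := by simp [contract]

theorem contract_add_right (σ δ δ' : Derivation ℂ A A) :
    Ω.contract σ (δ + δ') = Ω.contract σ δ + Ω.contract σ δ' := by simp [contract]

theorem contract_sub_left (σ σ' δ : Derivation ℂ A A) :
    Ω.contract (σ - σ') δ = Ω.contract σ δ - Ω.contract σ' δ := by simp [contract]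

theorem contract_sub_right (σ δ δ' : Derivation ℂ A A) :
    Ω.contract σ (δ - δ') = Ω.contract σ δ - Ω.contract σ δ' := by simp [contract]

theorem contract_mem {σ δ : Derivation ℂ A A} (hσ : σ ∈ LieAlgGenOmega Ω)
    (hδ : δ ∈ LieAlgGenOmega Ω) : Ω.contract σ δ ∈ Ω.potentials :=
  ⟨⁅σ, δ⁆, LieSubalgebra.lie_mem _ hσ hδ,
    Ω.cartan σ δ (Ω.divFree_of_mem hσ) (Ω.divFree_of_mem hδ)⟩

/-- All multiples of `κ` by elements of its kernel lie in `Lie_alg^ω`. -/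
def IsKerStable (κ : Derivation ℂ A A) : Prop := ∀ f, κ f = 0 → f • κ ∈ LieAlgGenOmega Ω

variable {Ω} in
theorem IsKerStable.mem {κ : Derivation ℂ A A} (hκ : Ω.IsKerStable κ) : κ ∈ LieAlgGenOmega Ω := by
  simpa using hκ 1 κ.map_one_eq_zero

/-- The span of the products of elements of the kernels of `X` and `E`. -/
def kerProd (X E : Derivation ℂ A A) : Submodule ℂ A :=
  Submodule.span ℂ {a | ∃ f g, X f = 0 ∧ E g = 0 ∧ a = f * g}

theorem lie_smul_right (σ X : Derivation ℂ A A) (f : A) :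
    ⁅σ, f • X⁆ = σ f • X + f • ⁅σ, X⁆ := by
  ext a
  simp only [Derivation.commutator_apply, Derivation.smul_apply, Derivation.add_apply, smul_eq_mul,
    Derivation.leibniz]
  ring

theorem lie_smul_left (σ X : Derivation ℂ A A) (f : A) :
    ⁅f • σ, X⁆ = f • ⁅σ, X⁆ - X f • σ := by
  ext a
  simp only [Derivation.commutator_apply, Derivation.smul_apply, Derivation.sub_apply, smul_eq_mul,
    Derivation.leibniz]
  ring

variable {X E : Derivation ℂ A A} (hX : Ω.IsKerStable X) (hE : Ω.IsKerStable E)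
include hX hE

theorem smul_contract_mem {a : A} (ha : a ∈ kerProd X E) :
    a • Ω.contract X E ∈ Ω.potentials := by
  induction ha using Submodule.span_induction with
  | mem a ha =>
    obtain ⟨f, g, hf, hg, rfl⟩ := ha
    have := Ω.contract_mem (hX f hf) (hE g hg)
    rwa [contract_smul_left, contract_smul_right, smul_smul] at this
  | zero => simp
  | add a b _ _ ha hb => rw [add_smul]; exact add_mem ha hb
  | smul z a _ ha => rw [smul_assoc]; exact Submodule.smul_mem _ z ha

theorem lie_contract_mem {σ : Derivation ℂ A A} (hσ : σ ∈ LieAlgGenOmega Ω) {a : A}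
    (ha : a ∈ kerProd X E) :
    σ a • Ω.contract X E + a • (Ω.contract ⁅σ, X⁆ E + Ω.contract X ⁅σ, E⁆) ∈ Ω.potentials := by
  induction ha using Submodule.span_induction with
  | mem a ha =>
    obtain ⟨f, g, hf, hg, rfl⟩ := ha
    have h1 := Ω.contract_mem (LieSubalgebra.lie_mem _ hσ (hX f hf)) (hE g hg)
    have h2 := Ω.contract_mem (hX f hf) (LieSubalgebra.lie_mem _ hσ (hE g hg))
    rw [lie_smul_right] at h1 h2
    convert add_mem h1 h2 using 1
    simp only [contract_smul_left, contract_smul_right, contract_add_left, contract_add_right,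
      Derivation.leibniz, smul_eq_mul]
    module
  | zero => simp
  | add a b _ _ ha hb =>
    convert add_mem ha hb using 1
    rw [map_add]
    module
  | smul z a _ ha =>
    convert Submodule.smul_mem _ z ha using 1
    rw [Derivation.map_smul, smul_assoc, smul_assoc, ← smul_add]

theorem smul_contract_add_mem {κ : Derivation ℂ A A} (hκ : Ω.IsKerStable κ) {f : A}
    (hf : κ f = 0) {a : A} (ha : a ∈ kerProd X E) (hfa : f * a ∈ kerProd X E) :
    a • (X f • Ω.contract κ E + E f • Ω.contract X κ) ∈ Ω.potentials := by
  have h1 := Ω.lie_contract_mem hX hE (hκ f hf) ha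
  have h2 := Ω.lie_contract_mem hX hE hκ.mem hfa
  rw [lie_smul_left, lie_smul_left] at h1
  convert sub_mem h2 h1 using 1
  simp only [contract_smul_left, contract_smul_right, contract_sub_left, contract_sub_right,
    Derivation.leibniz, Derivation.smul_apply, smul_eq_mul, hf]
  module

end Potentials

section Local

variable {A : Type*} [CommRing A] [Algebra ℂ A] (Ω : VolumeForms A) (S : Subalgebra ℂ A) (c : S)

/-- The forms which become potentials after multiplication by `S` times some power of `c`. -/
def localPotentials : Submodule ℂ Ω.F0 where
  carrier := {τ | ∃ M : ℕ, ∀ r ∈ S, ((c : A) ^ M * r) • τ ∈ Ω.potentials}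
  add_mem' := by
    rintro τ τ' ⟨M, h⟩ ⟨M', h'⟩
    refine ⟨M + M', fun r hr => ?_⟩
    rw [smul_add]
    refine add_mem ?_ ?_
    · rw [pow_add, mul_assoc]
      exact h _ (mul_mem (pow_mem c.2 _) hr)
    · rw [pow_add, mul_comm ((c : A) ^ M), mul_assoc]
      exact h' _ (mul_mem (pow_mem c.2 _) hr)
  zero_mem' := ⟨0, fun r _ => by simp⟩
  smul_mem' := by
    rintro z τ ⟨M, h⟩
    refine ⟨M, fun r hr => ?_⟩
    rw [← algebraMap_smul A z, smul_comm, algebraMap_smul]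
    exact Submodule.smul_mem _ z (h r hr)

variable {X E : Derivation ℂ A A} (hX : Ω.IsKerStable X) (hE : Ω.IsKerStable E)
  (hprod : ∀ a, ∃ M : ℕ, ∀ r ∈ S, (c : A) ^ M * r * a ∈ kerProd X E)
include hX hE hprod

theorem smul_contract_mem_local (a : A) : a • Ω.contract X E ∈ Ω.localPotentials S c := by
  obtain ⟨M, hM⟩ := hprod a
  refine ⟨M, fun r hr => ?_⟩
  rw [smul_smul]
  exact Ω.smul_contract_mem hX hE (hM r hr)

theorem smul_contract_add_mem_local {κ : Derivation ℂ A A} (hκ : Ω.IsKerStable κ) {f : A}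
    (hf : κ f = 0) (a : A) :
    a • (X f • Ω.contract κ E + E f • Ω.contract X κ) ∈ Ω.localPotentials S c := by
  obtain ⟨M, hM⟩ := hprod a
  obtain ⟨M', hM'⟩ := hprod (f * a)
  refine ⟨M + M', fun r hr => ?_⟩
  rw [smul_smul]
  refine Ω.smul_contract_add_mem hX hE hκ hf ?_ ?_
  · convert hM _ (mul_mem (pow_mem c.2 M') hr) using 1
    rw [pow_add]
    ring
  · convert hM' _ (mul_mem (pow_mem c.2 M) hr) using 1
    rw [pow_add]
    ring

theorem exists_smul_contract_mem_local [IsDomain A] {s : A} (hEs : E s = 0) (hXs : X s ≠ 0)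
    {Y : Derivation ℂ A A} (hY : Ω.IsKerStable Y) (hYnil : IsLND Y) {s' c' : A} (hYs : Y s' = c')
    (hYc : Y c' = 0) (hc' : c' ≠ 0) (hEs' : E s' = 0) (hE0 : E ≠ 0) :
    ∃ h : A, h ≠ 0 ∧ ∀ a, (a * h) • Ω.contract Y E ∈ Ω.localPotentials S c := by
  by_cases hcase : ∃ f₁ f₂, Y f₁ = 0 ∧ Y f₂ = 0 ∧ X f₁ * E f₂ - X f₂ * E f₁ ≠ 0
  · obtain ⟨f₁, f₂, h₁, h₂, hne⟩ := hcase
    refine ⟨_, hne, fun a => ?_⟩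
    convert sub_mem (Ω.smul_contract_add_mem_local S c hX hE hprod hY h₁ (a * E f₂))
      (Ω.smul_contract_add_mem_local S c hX hE hprod hY h₂ (a * E f₁)) using 1
    module
  · push Not at hcase
    obtain ⟨f, hf, hEf⟩ := exists_ker_apply_ne_zero hYnil hYs hYc hc' hEs' hE0
    have hΔ := smul_eq_of_ker_le hYnil hYs hYc hc' (Δ := E f • X - X f • E) fun g hg => by
      simp only [Derivation.sub_apply, Derivation.smul_apply, smul_eq_mul]
      linear_combination -hcase f g hf hg
    set Δ := E f • X - X f • E
    have hne : Δ s' ≠ 0 := by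
      intro h0
      rw [h0, zero_smul] at hΔ
      have ha := congrArg (fun D : Derivation ℂ A A => D s) hΔ
      simp [Δ, hEs, hXs, hc', hEf] at ha
    refine ⟨X s * Δ s', mul_ne_zero hXs hne, fun a => ?_⟩
    have h1 := Ω.smul_contract_mem_local S c hX hE hprod (a * X s * c' * E f)
    have h2 := Ω.smul_contract_add_mem_local S c hX hE hprod hE hEs (a * c' * X f)
    rw [hEs, zero_smul, add_zero] at h2
    have h3 : Δ s' • Ω.contract Y E = c' • (E f • Ω.contract X E - X f • Ω.contract E E) := by
      rw [← contract_smul_left, ← hΔ, contract_smul_left, contract_sub_left, contract_smul_left,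
        contract_smul_left]
    convert sub_mem h1 h2 using 1
    rw [← mul_assoc, mul_smul, h3]
    module

end Local

end VolumeForms

namespace LocallyNilpotent

section Descent

variable {A B : Type*} [CommRing A] [Algebra ℂ A] [CommRing B] [Algebra ℂ B]

theorem exists_descent [Algebra.FiniteType ℂ A] {φ : A →ₐ[ℂ] B} (hφ : Function.Injective φ)
    {Δ : Derivation ℂ B B} (hΔ : IsLND Δ) {b : A} (hb : Δ (φ b) = 0)
    (hloc : ∀ y, ∃ (N : ℕ) (a : A), φ a = φ b ^ N * y) :
    ∃ (N : ℕ) (η : Derivation ℂ A A), IsLND η ∧ ∀ a, φ (η a) = φ b ^ N * Δ (φ a) := by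
  obtain ⟨S, hS⟩ := (Algebra.FiniteType.out : (⊤ : Subalgebra ℂ A).FG)
  choose N a ha using fun x => hloc (Δ (φ x))
  have hex : ∀ x, ∃ y, φ y = φ b ^ S.sup N * Δ (φ x) := by
    intro x
    have hx : x ∈ Algebra.adjoin ℂ (S : Set A) := hS ▸ Algebra.mem_top
    induction hx using Algebra.adjoin_induction with
    | mem x hx =>
      refine ⟨b ^ (S.sup N - N x) * a x, ?_⟩
      rw [map_mul, map_pow, ha, ← mul_assoc, ← pow_add, Nat.sub_add_cancel (Finset.le_sup hx)]
    | algebraMap z => exact ⟨0, by simp⟩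
    | add x y _ _ hx hy =>
      obtain ⟨x', hx⟩ := hx
      obtain ⟨y', hy⟩ := hy
      exact ⟨x' + y', by rw [map_add, hx, hy, map_add, map_add, mul_add]⟩
    | mul x y _ _ hx hy =>
      obtain ⟨x', hx⟩ := hx
      obtain ⟨y', hy⟩ := hy
      refine ⟨x * y' + y * x', ?_⟩
      simp only [map_add, map_mul, hx, hy, Derivation.leibniz, smul_eq_mul]
      ring
  choose η hη using hex
  let D : Derivation ℂ A A := Derivation.mk'
    { toFun := η
      map_add' := fun x y => hφ (by simp only [map_add, hη, mul_add])
      map_smul' := fun z x => hφ (by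
        simp only [map_smul, hη, Derivation.map_smul, mul_smul_comm, RingHom.id_apply]) }
    fun x y => hφ (by
      simp only [LinearMap.coe_mk, AddHom.coe_mk, hη, map_mul, map_add, Derivation.leibniz,
        smul_eq_mul]
      ring)
  have hD : ∀ a, φ (D a) = φ b ^ S.sup N * Δ (φ a) := hη
  refine ⟨S.sup N, D, ?_, hD⟩
  have hLND := isLND_iff_iterate.1 (isLND_smul hΔ (ker_pow Δ hb (S.sup N)))
  refine isLND_iff_iterate.2 fun x => ?_
  obtain ⟨n, hn⟩ := hLND (φ x)
  refine ⟨n, hφ ?_⟩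
  have hsemi : Function.Semiconj φ D (φ b ^ S.sup N • Δ : Derivation ℂ B B) := hD
  rw [hsemi.iterate_right n x, hn, map_zero]

end Descent

section TensorProduct

variable {C Y : Type*} [CommRing C] [Algebra ℂ C] [CommRing Y] [Algebra ℂ Y]

/-- The extension `1 ⊗ δ` of a derivation to a product. -/
def extend (C : Type*) [CommRing C] [Algebra ℂ C] (δ : Derivation ℂ Y Y) :
    Derivation ℂ (C ⊗[ℂ] Y) (C ⊗[ℂ] Y) :=
  Derivation.mk' (δ.toLinearMap.lTensor C) fun a b => by
    induction a using TensorProduct.induction_on with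
    | zero => simp
    | add a a' ha ha' => simp only [add_mul, map_add, ha, ha', smul_add, add_smul]; abel
    | tmul c y =>
      induction b using TensorProduct.induction_on with
      | zero => simp
      | add b b' hb hb' => simp only [mul_add, map_add, hb, hb', smul_add, add_smul]; abel
      | tmul c' y' =>
        simp [TensorProduct.tmul_add, mul_comm c' c]

theorem extend_tmul (δ : Derivation ℂ Y Y) (c : C) (y : Y) :
    extend C δ (c ⊗ₜ y) = c ⊗ₜ δ y := rfl

theorem isLND_extend {δ : Derivation ℂ Y Y} (hδ : IsLND δ) : IsLND (extend C δ) := by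
  rw [isLND_iff_iterate] at hδ ⊢
  intro a
  induction a using TensorProduct.induction_on with
  | zero => exact ⟨0, rfl⟩
  | add a b ha hb =>
    obtain ⟨m, hm⟩ := ha
    obtain ⟨n, hn⟩ := hb
    refine ⟨m + n, ?_⟩
    rw [iterate_map_add, iterate_eq_zero_of_le _ (Nat.le_add_right m n) hm,
      iterate_eq_zero_of_le _ (Nat.le_add_left n m) hn, add_zero]
  | tmul c y =>
    obtain ⟨n, hn⟩ := hδ y
    refine ⟨n, ?_⟩
    have hsemi : Function.Semiconj (fun y => c ⊗ₜ[ℂ] y) δ (extend C δ) := fun _ => rfl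
    have := hsemi.iterate_right n y
    rw [hn, TensorProduct.tmul_zero] at this
    exact this.symm

end TensorProduct

theorem exists_vertical {A R Y : Type*} [CommRing A] [IsDomain A] [Algebra ℂ A]
    [Algebra.FiniteType ℂ A] [CommRing R] [IsDomain R] [Algebra ℂ R] [CommRing Y] [IsDomain Y]
    [Algebra ℂ Y] (π : R →ₐ[ℂ] A) {δ : Derivation ℂ Y Y} (hδ : IsLND δ) (hδ0 : δ ≠ 0) {α : R}
    (hα : α ≠ 0) (e : Localization.Away (π α) ≃+* (Localization.Away α ⊗[ℂ] Y))
    (he : ∀ r : R, e (algebraMap A (Localization.Away (π α)) (π r)) =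
        (algebraMap R (Localization.Away α) r) ⊗ₜ[ℂ] 1) :
    Function.Injective π ∧ ∃ η : Derivation ℂ A A, IsLND η ∧ η ≠ 0 ∧ ∀ r, η (π r) = 0 := by
  have hR : Function.Injective (algebraMap R (Localization.Away α)) :=
    IsLocalization.injective _ (powers_le_nonZeroDivisors_of_noZeroDivisors hα)
  have : Nontrivial (Localization.Away α) := hR.nontrivial
  have hleft : Function.Injective fun c : Localization.Away α => c ⊗ₜ[ℂ] (1 : Y) :=
    Algebra.TensorProduct.includeLeft_injective (S := ℂ) (algebraMap ℂ Y).injective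
  have hright : Function.Injective fun y : Y => (1 : Localization.Away α) ⊗ₜ[ℂ] y :=
    Algebra.TensorProduct.includeRight_injective (algebraMap ℂ (Localization.Away α)).injective
  have hπ : Function.Injective π := by
    rw [injective_iff_map_eq_zero]
    intro r hr
    have h := he r
    rw [hr, map_zero, map_zero] at h
    apply hR
    apply hleft
    simp [← h]
  refine ⟨hπ, ?_⟩
  have hπα : π α ≠ 0 := (map_ne_zero_iff π hπ).2 hα
  have hA : Function.Injective (algebraMap A (Localization.Away (π α))) :=
    IsLocalization.injective _ (powers_le_nonZeroDivisors_of_noZeroDivisors hπα)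
  let φ : A →ₐ[ℂ] (Localization.Away α ⊗[ℂ] Y) :=
    { (e : _ →+* _).comp (algebraMap A (Localization.Away (π α))) with
      commutes' := fun z => by
        have h := he (algebraMap ℂ R z)
        rw [AlgHom.commutes, ← IsScalarTower.algebraMap_apply] at h
        exact h }
  have hφ : ∀ a, φ a = e (algebraMap A (Localization.Away (π α)) a) := fun _ => rfl
  have hφinj : Function.Injective φ := e.injective.comp hA
  have hφπ : ∀ r, φ (π r) = (algebraMap R (Localization.Away α) r) ⊗ₜ[ℂ] 1 := he
  have hker : ∀ r, extend (Localization.Away α) δ (φ (π r)) = 0 := fun r => by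
    rw [hφπ, extend_tmul, Derivation.map_one_eq_zero, TensorProduct.tmul_zero]
  have hunit : IsUnit (φ (π α)) := by
    rw [hφπ]
    exact (IsLocalization.Away.algebraMap_isUnit α).map
      (Algebra.TensorProduct.includeLeft : Localization.Away α →ₐ[ℂ] Localization.Away α ⊗[ℂ] Y)
  have hloc : ∀ y, ∃ (N : ℕ) (a : A), φ a = φ (π α) ^ N * y := by
    intro y
    obtain ⟨N, a, ha⟩ := IsLocalization.Away.surj (π α) (e.symm y)
    refine ⟨N, a, ?_⟩
    rw [hφ, ← ha, map_mul, map_pow, e.apply_symm_apply, mul_comm, hφ]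
  obtain ⟨N, η, hη, hηφ⟩ := exists_descent hφinj (isLND_extend hδ) (hker α) hloc
  refine ⟨η, hη, ?_, fun r => hφinj ?_⟩
  · rintro rfl
    apply hδ0
    ext y
    obtain ⟨n, a, ha⟩ := hloc (1 ⊗ₜ y)
    have h := hηφ a
    rw [ha, Derivation.leibniz, ker_pow _ (hker α), smul_zero, add_zero, extend_tmul, smul_eq_mul,
      Derivation.zero_apply, map_zero] at h
    apply hright
    have h' := (hunit.pow n).mul_right_eq_zero.1 ((hunit.pow N).mul_right_eq_zero.1 h.symm)
    simpa using h'
  · rw [hηφ, hker, mul_zero, map_zero]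

end LocallyNilpotent

theorem span_range_eq_top_of_no_common_zero {R : Type*} [CommRing R] [Algebra ℂ R]
    [Algebra.FiniteType ℂ R] {ι : Type*} {α : ι → R}
    (hα : ¬ ∃ q : R →ₐ[ℂ] ℂ, ∀ i, q (α i) = 0) : Ideal.span (Set.range α) = ⊤ := by
  by_contra hne
  obtain ⟨m, hm, hle⟩ := Ideal.exists_le_maximal _ hne
  let := Ideal.Quotient.field m
  have hfin : Module.Finite ℂ (R ⧸ m) := finite_of_finite_type_of_isJacobsonRing ℂ (R ⧸ m)
  have hbij : Function.Bijective (algebraMap ℂ (R ⧸ m)) :=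
    IsAlgClosed.algebraMap_bijective_of_isIntegral
  let q := (AlgEquiv.ofBijective (Algebra.ofId ℂ (R ⧸ m)) hbij).symm
  refine hα ⟨(q : (R ⧸ m) →ₐ[ℂ] ℂ).comp (Ideal.Quotient.mkₐ ℂ m), fun i => ?_⟩
  have hi : Ideal.Quotient.mkₐ ℂ m (α i) = 0 :=
    Ideal.Quotient.eq_zero_iff_mem.2 (hle (Ideal.subset_span ⟨i, rfl⟩))
  rw [AlgHom.comp_apply, hi, map_zero]

namespace VolumeForms

open LocallyNilpotent

section Global

variable {A : Type*} [CommRing A] [Algebra ℂ A] (Ω : VolumeForms A)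

theorem exists_isKerStable [IsDomain A] [Algebra.FiniteType ℂ A] {κ : Derivation ℂ A A}
    (hκ : IsLND κ) {s c : A} (hs : κ s = c) (hc : κ c = 0) (hc0 : c ≠ 0) (μ : Derivation ℂ A A)
    {f : A} (hf : κ f = 0) (hμ : μ f ≠ 0) :
    ∃ b, b ≠ 0 ∧ κ b = 0 ∧ Ω.IsKerStable (b • κ) := by
  obtain ⟨b, hb0, hb, hdiv⟩ := Ω.exists_forall_ker_divFree hκ hs hc hc0 μ hf hμ
  refine ⟨b, hb0, hb, fun g hg => LieSubalgebra.subset_lieSpan ⟨?_, hdiv g ?_⟩⟩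
  · exact isCompleteField _ (isLND_smul (isLND_smul hκ hb) hg)
  · exact (mul_eq_zero.1 hg).resolve_left hb0

theorem mem_potentials_of_forall_local {R ι : Type*} [CommRing R] [Algebra ℂ R] [Finite ι]
    (π : R →ₐ[ℂ] A) {c : ι → R} (hc : Ideal.span (Set.range c) = ⊤) {τ : Ω.F0}
    (hτ : ∀ j, τ ∈ Ω.localPotentials π.range (π.rangeRestrict (c j))) : τ ∈ Ω.potentials := by
  have := Fintype.ofFinite ι
  choose M hM using hτ
  have h := Ideal.span_pow_eq_top _ hc (Finset.univ.sup M)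
  rw [← Set.range_comp, Ideal.eq_top_iff_one, Ideal.mem_span_range_iff_exists_fun] at h
  obtain ⟨x, hx⟩ := h
  rw [← one_smul A τ, ← map_one π, ← hx, map_sum, Finset.sum_smul]
  refine sum_mem fun j _ => ?_
  have h := hM j (π (c j ^ (Finset.univ.sup M - M j) * x j)) ⟨_, rfl⟩
  convert h using 2
  simp only [Function.comp_apply, AlgHom.coe_codRestrict, AlgHom.rangeRestrict, map_mul, map_pow]
  conv_lhs => rw [← Nat.add_sub_cancel' (Finset.le_sup (f := M) (Finset.mem_univ j)), pow_add]
  exact mul_comm _ _ |>.trans (mul_assoc _ _ _)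

theorem exists_pow_mul_mem_kerProd {R : Type*} [CommRing R] [Algebra ℂ R] (π : R →ₐ[ℂ] A)
    {κ X E : Derivation ℂ A A} (hκ : IsLND κ) (hX : ∀ f, κ f = 0 → X f = 0)
    (hE : ∀ r, E (π r) = 0) {r c : R} (hr : κ (π r) = π c) (hc : κ (π c) = 0) (a : A) :
    ∃ M : ℕ, ∀ y ∈ π.range, π c ^ M * y * a ∈ kerProd X E := by
  obtain ⟨M, hM⟩ := exists_pow_mul_mem_span hκ hr hc a
  refine ⟨M, ?_⟩
  rintro _ ⟨y, rfl⟩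
  rw [mul_right_comm]
  change _ * π y ∈ _
  generalize π c ^ M * a = x at hM
  induction hM using Submodule.span_induction with
  | mem x hx =>
    obtain ⟨f, n, hf, rfl⟩ := hx
    exact Submodule.subset_span ⟨f, π (r ^ n * y), hX f hf, hE _, by
      rw [map_mul, map_pow, mul_assoc]⟩
  | zero => rw [zero_mul]; exact zero_mem _
  | add x x' _ _ hx hx' => rw [add_mul]; exact add_mem hx hx'
  | smul z x _ hx => rw [smul_mul_assoc]; exact Submodule.smul_mem _ z hx

theorem contract_mem_potentials_of_mem {ι : Type*} {ξ : ι → Derivation ℂ A A}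
    {E : Derivation ℂ A A} {H : A} (hH : ∀ i a, (a * H) • Ω.contract (ξ i) E ∈ Ω.potentials)
    {ζ : Derivation ℂ A A} (hζ : ζ ∈ Ideal.span {H} • Submodule.span A (Set.range ξ)) :
    Ω.contract ζ E ∈ Ω.potentials := by
  have key : ∀ ν ∈ Submodule.span A (Set.range ξ), ∀ a,
      (a * H) • Ω.contract ν E ∈ Ω.potentials := by
    intro ν hν
    induction hν using Submodule.span_induction with
    | mem ν h =>
      obtain ⟨i, rfl⟩ := h
      exact hH i
    | zero => intro a; simp [contract]
    | add ν ν' _ _ h h' =>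
      intro a
      rw [contract_add_left, smul_add]
      exact add_mem (h a) (h' a)
    | smul b ν _ h =>
      intro a
      rw [contract_smul_left, smul_smul, mul_right_comm]
      exact h _
  induction hζ using Submodule.smul_induction_on' with
  | smul x hx ν hν =>
    obtain ⟨a, rfl⟩ := Ideal.mem_span_singleton'.1 hx
    rw [contract_smul_left]
    exact key ν hν a
  | add ν _ ν' _ h h' =>
    rw [contract_add_left]
    exact add_mem h h'

/-- If the fields `ξ i` have slices over the complements of the zeros of `c i` in the base, then
all multiples of the forms `contract (ξ i) η` by a suitable function are potentials. -/
theorem exists_vertical_forall_mem_potentials [IsDomain A] [Algebra.FiniteType ℂ A] {R ι : Type*}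
    [CommRing R] [Algebra ℂ R] [Finite ι] (π : R →ₐ[ℂ] A) (hπ : Function.Injective π)
    {ξ : ι → Derivation ℂ A A} (hξ : ∀ i, IsLND (ξ i)) {r c : ι → R}
    (hr : ∀ i, ξ i (π (r i)) = π (c i)) (hc : ∀ i, ξ i (π (c i)) = 0) (hc0 : ∀ i, c i ≠ 0)
    (hspan : Ideal.span (Set.range c) = ⊤) {η : Derivation ℂ A A} (hη : IsLND η) (hη0 : η ≠ 0)
    (hηπ : ∀ r, η (π r) = 0) (i₀ : ι) :
    ∃ b H : A, b • η ≠ 0 ∧ H ≠ 0 ∧ η b = 0 ∧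
      ∀ i a, (a * H) • Ω.contract (ξ i) (b • η) ∈ Ω.potentials := by
  have := Fintype.ofFinite ι
  have hπc : ∀ i, π (c i) ≠ 0 := fun i => (map_ne_zero_iff π hπ).2 (hc0 i)
  obtain ⟨s, hs0, hs⟩ := exists_slice hη hη0
  obtain ⟨b, hb0, hb, hbη⟩ := Ω.exists_isKerStable hη rfl hs hs0 (ξ i₀) (hηπ (r i₀))
    (by rw [hr]; exact hπc i₀)
  have hX : ∀ i, ∃ d, d ≠ 0 ∧ ξ i d = 0 ∧ Ω.IsKerStable (d • ξ i) := fun i => by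
    obtain ⟨f, hf, hηf⟩ := exists_ker_apply_ne_zero (hξ i) (hr i) (hc i) (hπc i) (hηπ _) hη0
    exact Ω.exists_isKerStable (hξ i) (hr i) (hc i) (hπc i) η hf hηf
  choose d hd0 hd hdξ using hX
  have hEπ : ∀ y, (b • η) (π y) = 0 := fun y => by simp [hηπ]
  have hE0 : b • η ≠ 0 := fun h0 => (mul_ne_zero hb0 hs0) (DFunLike.congr_fun h0 s)
  have hh : ∀ i j, ∃ h : A, h ≠ 0 ∧ ∀ a, (a * h) • Ω.contract (d i • ξ i) (b • η) ∈
      Ω.localPotentials π.range (π.rangeRestrict (c j)) := fun i j =>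
    Ω.exists_smul_contract_mem_local π.range (π.rangeRestrict (c j)) (hdξ j) hbη
      (exists_pow_mul_mem_kerProd π (hξ j) (fun f hf => by simp [hf]) hEπ (hr j) (hc j))
      (hEπ (r j)) (by simp [hr, hd0, hπc]) (hdξ i) (isLND_smul (hξ i) (hd i)) (s' := π (r i)) rfl
      (by simp [hr, hc, hd]) (by simp [hr, hd0, hπc]) (hEπ _) hE0
  choose h hh0 hh using hh
  refine ⟨b, ∏ i, (d i * ∏ j, h i j), hE0, Finset.prod_ne_zero_iff.2 fun i _ =>
    mul_ne_zero (hd0 i) (Finset.prod_ne_zero_iff.2 fun j _ => hh0 i j), hb, fun i a => ?_⟩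
  refine Ω.mem_potentials_of_forall_local π hspan fun j => ?_
  obtain ⟨x, hx⟩ := Finset.dvd_prod_of_mem (fun i => d i * ∏ j, h i j) (Finset.mem_univ i)
  obtain ⟨y, hy⟩ := Finset.dvd_prod_of_mem (h i) (Finset.mem_univ j)
  convert hh i j (a * x * y) using 1
  rw [hx, hy, contract_smul_left, smul_smul]
  congr 1
  ring

end Global

end VolumeForms

theorem statement15 (A R CY : Type) [CommRing A] [IsDomain A] [Algebra ℂ A]
    [CommRing R] [IsDomain R] [Algebra ℂ R] [CommRing CY] [IsDomain CY] [Algebra ℂ CY]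
    (hfgA : Algebra.FiniteType ℂ A) (hsmA : Algebra.FormallySmooth ℂ A)
    (hfgR : Algebra.FiniteType ℂ R) (hsmR : Algebra.FormallySmooth ℂ R)
    (hfgY : Algebra.FiniteType ℂ CY)
    (πs : R →ₐ[ℂ] A)
    (δ : Derivation ℂ CY CY) (hδ : IsLND δ) (hδ0 : δ ≠ 0)
    (k : ℕ) (α : Fin k → R)
    (hnocommonzero : ¬ ∃ q : R →ₐ[ℂ] ℂ, ∀ i, q (α i) = 0)
    (htriv : ∀ i, ∃ e : Localization.Away (πs (α i)) ≃+*
        (Localization.Away (α i) ⊗[ℂ] CY),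
      ∀ r : R, e (algebraMap A (Localization.Away (πs (α i))) (πs r)) =
        (algebraMap R (Localization.Away (α i)) r) ⊗ₜ[ℂ] 1)
    -- the semisimple group S acting on X and B with π equivariant
    (m : ℕ) (Ssub : Subgroup (GLn m)) (hS : IsSemisimpleGrp Ssub)
    (ρX : AlgebraicAction Ssub A) (ρB : AlgebraicAction Ssub R)
    (hequiv : ∀ (s : ↥Ssub) (r : R), ρX.act s (πs r) = πs (ρB.act s r))
    -- the fields ξ_i, induced by one-parameter unipotent subgroups of S
    (ξ : Fin k → Derivation ℂ A A) (hξLND : ∀ i, IsLND (ξ i))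
    (hflows : ∀ i, ∃ c : ℂ → ↥Ssub, c 0 = 1 ∧ (∀ t s : ℂ, c (t + s) = c t * c s) ∧
      (∀ ij : Fin m × Fin m, ∃ q : Polynomial ℂ, ∀ t : ℂ,
        ((c t : GLn m) : Matrix (Fin m) (Fin m) ℂ) ij.1 ij.2 = q.eval t) ∧
      ∀ (t : ℂ) (a : A), ∃ N : ℕ, ((ξ i).toLinearMap ^ N) a = 0 ∧
        ρX.act (c t) a = ∑ j ∈ Finset.range N,
          (t ^ j / (j.factorial : ℂ)) • (((ξ i).toLinearMap ^ j) a))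
    -- (i) ξ_i preserves ℂ[B], inducing ξ_i′ on B
    (ξ' : Fin k → Derivation ℂ R R)
    (hinduce : ∀ i (r : R), ξ i (πs r) = πs (ξ' i r))
    -- (ii) α_i ∈ Ker ξ_i′
    (hα : ∀ i, ξ' i (α i) = 0)
    -- (iii) ξ_i′ admits a slice on B_i
    (hslice : ∀ i, ∃ (r : R) (l : ℕ), ξ' i r = α i ^ l ∧ α i ^ l ≠ 0)
    -- (★)
    (hstar : ∀ (p : A →ₐ[ℂ] ℂ) (ν : Derivation ℂ A A),
      ν ∈ Submodule.span A (Set.range ξ) →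
      fieldAt p ν ∈ Submodule.span ℂ
        {w : A →ₗ[ℂ] ℂ | ∃ j, p (πs (α j)) ≠ 0 ∧ w = fieldAt p (ξ j)})
    -- the volume form
    (Ω : VolumeForms A) :
    ∃ η : Derivation ℂ A A, IsLND η ∧ η ≠ 0 ∧ (∀ r : R, η (πs r) = 0) ∧
      ∃ J : Ideal A, J ≠ ⊥ ∧
        ∀ ζ ∈ (J • Submodule.span A (Set.range ξ) : Submodule A (Derivation ℂ A A)),
          ∃ ν ∈ LieAlgGenOmega Ω, Ω.ι2 ν Ω.vol = Ω.d0 (Ω.ι1 ζ (Ω.ι2 η Ω.vol)) := by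
  choose r l hr hne using hslice
  have htop := span_range_eq_top_of_no_common_zero hnocommonzero
  have hne0 : ∃ i, α i ≠ 0 := by
    by_contra! h0
    have : Ideal.span (Set.range α) ≤ ⊥ := Ideal.span_le.2 (by rintro _ ⟨i, rfl⟩; exact h0 i)
    exact top_ne_bot (htop ▸ le_bot_iff.1 this)
  obtain ⟨i₀, hi₀⟩ := hne0
  obtain ⟨e, he⟩ := htriv i₀
  obtain ⟨hπ, η, hη, hη0, hηπ⟩ := LocallyNilpotent.exists_vertical πs hδ hδ0 hi₀ e he
  have hspan : Ideal.span (Set.range fun i => α i ^ l i) = ⊤ := by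
    have h := Ideal.span_pow_eq_top _ htop (Finset.univ.sup l)
    rw [← Set.range_comp] at h
    refine top_le_iff.1 (h.ge.trans (Ideal.span_le.2 ?_))
    rintro _ ⟨i, rfl⟩
    exact Ideal.mem_of_dvd _ (pow_dvd_pow _ (Finset.le_sup (Finset.mem_univ i)))
      (Ideal.subset_span ⟨i, rfl⟩)
  obtain ⟨b, H, hbη, hH0, hb, hH⟩ := Ω.exists_vertical_forall_mem_potentials πs hπ hξLND
    (r := r) (c := fun i => α i ^ l i) (fun i => by rw [hinduce, hr])
    (fun i => by rw [map_pow, LocallyNilpotent.ker_pow _ (by rw [hinduce, hα, map_zero])])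
    hne hspan hη hη0 hηπ i₀
  exact ⟨b • η, LocallyNilpotent.isLND_smul hη hb, hbη, fun y => by simp [hηπ],
    Ideal.span {H}, by simpa using hH0, fun ζ hζ => Ω.contract_mem_potentials_of_mem hH hζ⟩
end
end

section
/- Let W = X × Y, where X is a Γ-variety homogeneous under an algebraic action of a linear algebraic group G commuting with the Γ-action such that: the isotropy subgroup at some point x ∈ X of the group of algebraic automorphisms of X commuting with Γ acts irreducibly on T_xX, and there exists a Γ-compatible pair (ξ, η) on X with η(x) ≠ 0. Suppose Y and W are Γ-varieties such that the projections W → X and W → Y are Γ-equivariant, and at every point y ∈ Y the values of Γ-invariant complete algebraic vector fields generate T_yY. Then W has Γ-ADP, i.e. the Lie algebra generated by Γ-invariant complete algebraic vector fields on W coincides with the space of all Γ-invariant algebraic vector fields on W. -/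
/-!
STATEMENT 19 (Lemma `adpl1`): Let W = X × Y, where X is a Γ-variety homogeneous under an
algebraic action of a linear algebraic group G commuting with the Γ-action, such that the
isotropy subgroup at some point x of the group of algebraic automorphisms of X commuting
with Γ acts irreducibly on T_xX, and there exists a Γ-compatible pair (ξ, η) on X with
η(x) ≠ 0.  Suppose Y and W are Γ-varieties such that the projections W → X and W → Y are
Γ-equivariant (so that the Γ-action on W is the product action), and at every point
y ∈ Y the values of Γ-invariant complete algebraic vector fields generate T_yY.  Then W
has Γ-ADP: the Lie algebra generated by Γ-invariant complete algebraic vector fields on W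
coincides with the space of all Γ-invariant algebraic vector fields on W.

Modelling conventions: X and Y are given by coordinate rings AX, AY and W by
`AX ⊗[ℂ] AY`; tangent vectors at a point are point derivations; the Γ-action on W is the
tensor product of the actions on the factors (this is exactly Γ-equivariance of the two
projections).  Automorphisms of X are ℂ-algebra automorphisms of AX (all of which are
algebraic since AX is finitely generated).
-/

noncomputable section

open scoped TensorProduct

/-- Tangent space at a point: the point derivations. -/
def pointDerivations {A : Type*} [CommRing A] [Algebra ℂ A] (p : A →ₐ[ℂ] ℂ) :
    Submodule ℂ (A →ₗ[ℂ] ℂ) where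
  carrier := {u | ∀ a b : A, u (a * b) = p a * u b + p b * u a}
  add_mem' := by
    intro u v hu hv a b
    simp only [LinearMap.add_apply, hu a b, hv a b]; ring
  zero_mem' := by intro a b; simp
  smul_mem' := by
    intro c u hu a b
    simp only [LinearMap.smul_apply, smul_eq_mul, hu a b]; ring

/-- Γ-invariance of a vector field: it commutes with the Γ-action. -/
def GammaInvField {A : Type*} [CommRing A] [Algebra ℂ A] {Γ : Type*} [Group Γ]
    (actΓ : Γ →* (A ≃ₐ[ℂ] A)) (ξ : Derivation ℂ A A) : Prop :=
  ∀ (γ : Γ) (a : A), actΓ γ (ξ a) = ξ (actΓ γ a)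

/-- The subalgebra ℂ[X, Γ] = ℂ[X/Γ] of Γ-invariant regular functions. -/
def invariantSubalgebra {A : Type*} [CommRing A] [Algebra ℂ A] {Γ : Type*} [Group Γ]
    (actΓ : Γ →* (A ≃ₐ[ℂ] A)) : Subalgebra ℂ A :=
  ⨅ γ : Γ, AlgHom.equalizer (actΓ γ).toAlgHom (AlgHom.id ℂ A)

/-- A Γ-compatible pair of vector fields (Definition 2.2(3) of the paper): a pair of
nontrivial Γ-invariant complete algebraic vector fields (ξ, η) such that ξ is locally
nilpotent, the span of (Ker ξ ∩ ℂ[X,Γ])·(Ker η ∩ ℂ[X,Γ]) contains a nonzero ideal of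
ℂ[X,Γ], and some Γ-invariant a ∈ Ker η has ξ-degree 1. -/
def GammaCompatiblePair {A : Type*} [CommRing A] [Algebra ℂ A] {Γ : Type*} [Group Γ]
    (actΓ : Γ →* (A ≃ₐ[ℂ] A)) (ξ η : Derivation ℂ A A) : Prop :=
  IsCompleteField ξ ∧ IsCompleteField η ∧ ξ ≠ 0 ∧ η ≠ 0 ∧
  GammaInvField actΓ ξ ∧ GammaInvField actΓ η ∧ IsLND ξ ∧
  (∃ I : Ideal ↥(invariantSubalgebra actΓ), I ≠ ⊥ ∧
    ∀ h ∈ I, (h : A) ∈ Submodule.span ℂ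
      {w : A | ∃ f g : A, ξ f = 0 ∧ (∀ γ, actΓ γ f = f) ∧ η g = 0 ∧
        (∀ γ, actΓ γ g = g) ∧ w = f * g}) ∧
  (∃ a : A, η a = 0 ∧ (∀ γ, actΓ γ a = a) ∧ ξ a ≠ 0 ∧ ξ (ξ a) = 0)

def AlgebraicAction.Transitive {n : ℕ} {G : Subgroup (GLn n)} {A : Type*} [CommRing A]
    [Algebra ℂ A] (ρ : AlgebraicAction G A) : Prop :=
  ∀ p q : A →ₐ[ℂ] ℂ, ∃ g : ↥G, q = p.comp (ρ.act g).toAlgHom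

section Fields

variable {A : Type*} [CommRing A] [Algebra ℂ A]

theorem derivation_sum_apply {ι : Type*} (s : Finset ι) (F : ι → Derivation ℂ A A) (a : A) :
    (∑ i ∈ s, F i) a = ∑ i ∈ s, F i a := by
  classical
  induction s using Finset.induction_on with
  | empty => simp
  | insert i s hi ih => simp [Finset.sum_insert hi, ih]

/-- A complete field times a function of degree at most one along it is complete. -/
theorem IsCompleteField.smul {ξ : Derivation ℂ A A} (hξ : IsCompleteField ξ) {h : A}
    (hh : ξ (ξ h) = 0) : IsCompleteField (h • ξ) := by
  intro p
  obtain ⟨γ, hγ0, hγ⟩ := hξ p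
  have hk : ∀ t, γ t (ξ h) = p (ξ h) := by
    intro t
    have hd : ∀ s, HasDerivAt (fun s => γ s (ξ h)) 0 s := fun s => by
      simpa [hh] using hγ (ξ h) s
    have := is_const_of_deriv_eq_zero (fun s => (hd s).differentiableAt) (fun s => (hd s).deriv) t 0
    simpa [hγ0] using this
  have hl : ∀ t, γ t h = p h + p (ξ h) * t := by
    intro t
    have hd : ∀ s, HasDerivAt (fun s => γ s h - p (ξ h) * s) 0 s := fun s => by
      have h1 := hγ h s
      rw [hk] at h1
      exact (h1.sub ((hasDerivAt_id s).const_mul (p (ξ h)))).congr_deriv (by simp)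
    have := is_const_of_deriv_eq_zero (fun s => (hd s).differentiableAt) (fun s => (hd s).deriv) t 0
    simp only [hγ0, mul_zero, sub_zero] at this
    rw [← this]; ring
  obtain ⟨τ, hτ0, hτ⟩ : ∃ τ : ℂ → ℂ, τ 0 = 0 ∧
      ∀ t, HasDerivAt τ (p h + p (ξ h) * τ t) t := by
    by_cases hz : p (ξ h) = 0
    · refine ⟨fun t => p h * t, by simp, fun t => ?_⟩
      simpa [hz] using (hasDerivAt_id t).const_mul (p h)
    · refine ⟨fun t => p h * (Complex.exp (p (ξ h) * t) - 1) / p (ξ h), by simp, fun t => ?_⟩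
      have h1 := (((((hasDerivAt_id t).const_mul (p (ξ h))).cexp).sub_const 1).const_mul
        (p h)).div_const (p (ξ h))
      refine h1.congr_deriv ?_
      simp only [id]
      field_simp
      ring
  refine ⟨fun t => γ (τ t), by simp [hτ0, hγ0], fun a t => ?_⟩
  have := (hγ a (τ t)).comp t (hτ t)
  refine this.congr_deriv ?_
  simp only [Derivation.smul_apply, smul_eq_mul, map_mul, hl]
  ring

/-- Transport of a vector field by an automorphism. -/
def conjDer (α : A ≃ₐ[ℂ] A) : Derivation ℂ A A →ₗ[ℂ] Derivation ℂ A A where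
  toFun d := Derivation.mk' (α.toLinearMap ∘ₗ d.toLinearMap ∘ₗ α.symm.toLinearMap) (by
    intro a b
    simp)
  map_add' d e := by ext a; exact map_add α _ _
  map_smul' c d := by ext a; exact map_smul α c _

@[simp] theorem conjDer_apply (α : A ≃ₐ[ℂ] A) (d : Derivation ℂ A A) (a : A) :
    conjDer α d a = α (d (α.symm a)) := rfl

theorem conjDer_lie (α : A ≃ₐ[ℂ] A) (d e : Derivation ℂ A A) :
    conjDer α ⁅d, e⁆ = ⁅conjDer α d, conjDer α e⁆ := by
  ext a; simp [Derivation.commutator_apply]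

theorem conjDer_smul (α : A ≃ₐ[ℂ] A) (c : A) (d : Derivation ℂ A A) :
    conjDer α (c • d) = α c • conjDer α d := by
  ext a; simp

theorem IsCompleteField.conjDer {d : Derivation ℂ A A} (hd : IsCompleteField d)
    (α : A ≃ₐ[ℂ] A) : IsCompleteField (conjDer α d) := by
  intro p
  obtain ⟨γ, hγ0, hγ⟩ := hd (p.comp α.toAlgHom)
  refine ⟨fun t => (γ t).comp α.symm.toAlgHom, ?_, fun a t => ?_⟩
  · ext a; simp [hγ0]
  · simpa using hγ (α.symm a) t

@[simp] theorem fieldAt_apply (p : A →ₐ[ℂ] ℂ) (ξ : Derivation ℂ A A) (a : A) :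
    fieldAt p ξ a = p (ξ a) := rfl

theorem exists_point_of_isMaximal (hA : Algebra.FiniteType ℂ A) (m : Ideal A) [m.IsMaximal] :
    ∃ p : A →ₐ[ℂ] ℂ, ∀ a, p a = 0 ↔ a ∈ m := by
  let : Field (A ⧸ m) := Ideal.Quotient.field m
  have : Algebra.FiniteType ℂ (A ⧸ m) :=
    hA.of_surjective (Ideal.Quotient.mkₐ ℂ m) (Ideal.Quotient.mkₐ_surjective ℂ m)
  have : Module.Finite ℂ (A ⧸ m) := finite_of_finite_type_of_isJacobsonRing _ _
  have hb : Function.Bijective (algebraMap ℂ (A ⧸ m)) :=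
    IsAlgClosed.algebraMap_bijective_of_isIntegral
  let e : ℂ ≃ₐ[ℂ] (A ⧸ m) := AlgEquiv.ofBijective (Algebra.ofId ℂ (A ⧸ m)) hb
  refine ⟨e.symm.toAlgHom.comp (Ideal.Quotient.mkₐ ℂ m), fun a => ?_⟩
  simp [Ideal.Quotient.eq_zero_iff_mem]

theorem exists_point_ne_zero [IsDomain A] (hA : Algebra.FiniteType ℂ A) {a : A} (ha : a ≠ 0) :
    ∃ p : A →ₐ[ℂ] ℂ, p a ≠ 0 := by
  have : IsJacobsonRing A := isJacobsonRing_of_finiteType (A := ℂ)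
  have hj : (⊥ : Ideal A).jacobson = ⊥ := by
    rw [← Ideal.radical_eq_jacobson]
    exact (Ideal.isPrime_bot (α := A)).isRadical.radical
  have hn : a ∉ (⊥ : Ideal A).jacobson := by rw [hj]; simpa using ha
  rw [Ideal.jacobson, Ideal.mem_sInf] at hn
  push Not at hn
  obtain ⟨m, ⟨-, hm⟩, ham⟩ := hn
  obtain ⟨p, hp⟩ := exists_point_of_isMaximal hA m
  exact ⟨p, fun h => ham ((hp a).1 h)⟩

/-- A finite dual basis of the module of vector fields on a smooth affine variety. -/
theorem exists_dual_basis_derivation (hA : Algebra.FiniteType ℂ A)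
    (hs : Algebra.FormallySmooth ℂ A) :
    ∃ (n : ℕ) (f : Fin n → Derivation ℂ A A) (ω : Fin n → Ω[A⁄ℂ]),
      ∀ d : Derivation ℂ A A, d = ∑ i, d.liftKaehlerDifferential (ω i) • f i := by
  obtain ⟨n, g, s, -, -, hgs⟩ := Module.Finite.exists_comp_eq_id_of_projective A Ω[A⁄ℂ]
  refine ⟨n, fun i => ((LinearMap.proj i : (Fin n → A) →ₗ[A] A) ∘ₗ s).compDer
    (KaehlerDifferential.D ℂ A), fun i => g (Pi.single i 1), fun d => ?_⟩
  ext a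
  have h1 : g (s (KaehlerDifferential.D ℂ A a)) = KaehlerDifferential.D ℂ A a :=
    LinearMap.congr_fun hgs _
  rw [← Derivation.liftKaehlerDifferential_comp_D d a, ← h1,
    pi_eq_sum_univ (s (KaehlerDifferential.D ℂ A a))]
  have : ∀ i : Fin n, (fun j : Fin n => if i = j then (1 : A) else 0) = Pi.single i 1 := by
    intro i; ext j; simp [Pi.single_apply, eq_comm]
  have h2 : ∀ i : Fin n, (s (KaehlerDifferential.D ℂ A a)) i =
      ((LinearMap.proj i : (Fin n → A) →ₗ[A] A) ∘ₗ s).compDer (KaehlerDifferential.D ℂ A) a := fun i => rfl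
  rw [map_sum, map_sum, derivation_sum_apply]
  simp only [this, map_smul, Derivation.smul_apply, smul_eq_mul, h2]
  exact Finset.sum_congr rfl fun i _ => mul_comm _ _

/-- A submodule of vector fields on a smooth affine variety which spans all tangent spaces
contains all vector fields. -/
theorem submodule_eq_top_of_span_tangent (hA : Algebra.FiniteType ℂ A)
    (hs : Algebra.FormallySmooth ℂ A) (M : Submodule A (Derivation ℂ A A))
    (hM : ∀ p : A →ₐ[ℂ] ℂ, ∀ u ∈ pointDerivations p, ∃ d ∈ M, fieldAt p d = u) : M = ⊤ := by
  obtain ⟨n, f, ω, hf⟩ := exists_dual_basis_derivation hA hs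
  have hspan : Submodule.span A (Set.range f) = ⊤ := by
    rw [eq_top_iff]
    rintro d -
    rw [hf d]
    exact Submodule.sum_mem _ fun i _ => Submodule.smul_mem _ _ (Submodule.subset_span ⟨i, rfl⟩)
  have : Module.Finite A (Derivation ℂ A A) :=
    ⟨hspan ▸ Submodule.fg_span (Set.finite_range f)⟩
  by_contra hne
  have hann : Module.annihilator A (Derivation ℂ A A ⧸ M) ≠ ⊤ := by
    intro h
    rw [Module.annihilator_eq_top_iff] at h
    exact hne ((Submodule.Quotient.subsingleton_iff).1 h)
  obtain ⟨m, hm, hle⟩ := Ideal.exists_le_maximal _ hann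
  obtain ⟨p, hp⟩ := exists_point_of_isMaximal hA m
  have htop : (⊤ : Submodule A (Derivation ℂ A A ⧸ M)) ≤ m • ⊤ := by
    rintro q -
    obtain ⟨d, rfl⟩ := Submodule.mkQ_surjective M q
    obtain ⟨e, heM, he⟩ := hM p (fieldAt p d) (by
      intro a b; simp)
    have h1 : ∀ a, (d - e) a ∈ m := by
      intro a
      rw [← hp]
      have := LinearMap.congr_fun he a
      simp only [fieldAt_apply] at this
      simp [this]
    have h2 : ∀ w : Ω[A⁄ℂ], (d - e).liftKaehlerDifferential w ∈ m := by
      intro w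
      have hw : w ∈ Submodule.span A (Set.range (KaehlerDifferential.D ℂ A)) := by
        rw [KaehlerDifferential.span_range_derivation]; trivial
      induction hw using Submodule.span_induction with
      | mem x hx => obtain ⟨a, rfl⟩ := hx; simpa using h1 a
      | zero => simp
      | add x y _ _ hx hy => rw [map_add]; exact add_mem hx hy
      | smul a x _ hx => rw [map_smul]; exact Ideal.mul_mem_left _ _ hx
    have h3 : M.mkQ d = M.mkQ (d - e) := by
      have : M.mkQ e = 0 := by simpa using heM
      rw [map_sub, this, sub_zero]
    rw [h3, hf (d - e), map_sum]
    refine Submodule.sum_mem _ fun i _ => ?_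
    rw [map_smul]
    exact Submodule.smul_mem_smul (h2 _) trivial
  obtain ⟨r, hr, hr0⟩ := Submodule.exists_sub_one_mem_and_smul_eq_zero_of_fg_of_le_smul m
    (⊤ : Submodule A (Derivation ℂ A A ⧸ M)) Module.Finite.fg_top htop
  have hrm : r ∈ m := hle (Module.mem_annihilator.2 fun q => hr0 q trivial)
  exact hm.ne_top ((Ideal.eq_top_iff_one _).2 (by simpa using sub_mem hrm hr))

end Fields

section GammaFields

variable {A : Type*} [CommRing A] [Algebra ℂ A] {Γ : Type*} [Group Γ]

/-- The Lie algebra generated by the Γ-invariant complete algebraic vector fields. -/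
def completeLie (act : Γ →* (A ≃ₐ[ℂ] A)) : LieSubalgebra ℂ (Derivation ℂ A A) :=
  LieSubalgebra.lieSpan ℂ (Derivation ℂ A A) {ζ | IsCompleteField ζ ∧ GammaInvField act ζ}

/-- The largest submodule over the Γ-invariant functions contained in `completeLie act`. -/
def completeCore (act : Γ →* (A ≃ₐ[ℂ] A)) : Submodule ℂ (Derivation ℂ A A) where
  carrier := {d | ∀ c : A, (∀ γ, act γ c = c) → c • d ∈ completeLie act}
  add_mem' hd he c hc := by rw [smul_add]; exact add_mem (hd c hc) (he c hc)
  zero_mem' c hc := by rw [smul_zero]; exact zero_mem _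
  smul_mem' r d hd c hc := by
    rw [smul_comm]; exact (completeLie act).smul_mem r (hd c hc)

variable {act : Γ →* (A ≃ₐ[ℂ] A)}

theorem mem_completeLie {d : Derivation ℂ A A} (hd : IsCompleteField d)
    (hi : GammaInvField act d) : d ∈ completeLie act :=
  LieSubalgebra.subset_lieSpan ⟨hd, hi⟩

theorem GammaInvField.smul {d : Derivation ℂ A A} (hi : GammaInvField act d) {c : A}
    (hc : ∀ γ, act γ c = c) : GammaInvField act (c • d) := by
  intro γ a
  simp [hi γ a, hc γ]

theorem GammaInvField.of_mem_completeLie {d : Derivation ℂ A A} (hd : d ∈ completeLie act) :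
    GammaInvField act d := by
  induction hd using LieSubalgebra.lieSpan_induction with
  | mem x h => exact h.2
  | zero => intro γ a; simp
  | add x y _ _ hx hy => intro γ a; simp [hx γ, hy γ]
  | smul c x _ hx => intro γ a; simp [hx γ]
  | lie x y _ _ hx hy => intro γ a; simp [Derivation.commutator_apply, hx γ, hy γ]

theorem completeCore_le {d : Derivation ℂ A A} (hd : d ∈ completeCore act) :
    d ∈ completeLie act := by
  simpa using hd 1 (by simp)

theorem smul_mem_completeCore {d : Derivation ℂ A A} (hd : d ∈ completeCore act) {c : A}
    (hc : ∀ γ, act γ c = c) : c • d ∈ completeCore act := by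
  intro b hb
  rw [smul_smul]
  exact hd _ fun γ => by rw [map_mul, hb, hc]

theorem lie_mem_completeCore {d e : Derivation ℂ A A} (he : e ∈ completeLie act)
    (hd : d ∈ completeCore act) : ⁅e, d⁆ ∈ completeCore act := by
  intro c hc
  have h : c • ⁅e, d⁆ = ⁅e, c • d⁆ - e c • d := by
    ext a; simp [Derivation.commutator_apply]
  rw [h]
  refine sub_mem (LieSubalgebra.lie_mem _ he (hd c hc)) (hd _ fun γ => ?_)
  rw [GammaInvField.of_mem_completeLie he γ c, hc]

theorem conjDer_mem_completeLie {α : A ≃ₐ[ℂ] A} (hα : ∀ γ a, act γ (α a) = α (act γ a))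
    {d : Derivation ℂ A A} (hd : d ∈ completeLie act) : conjDer α d ∈ completeLie act := by
  have hα' : ∀ γ a, act γ (α.symm a) = α.symm (act γ a) := by
    intro γ a
    apply α.injective
    rw [← hα]; simp
  induction hd using LieSubalgebra.lieSpan_induction with
  | mem x h =>
    refine mem_completeLie (h.1.conjDer α) fun γ a => ?_
    simp [hα, h.2 γ, hα']
  | zero => simp
  | add x y _ _ hx hy => rw [map_add]; exact add_mem hx hy
  | smul c x _ hx => rw [map_smul]; exact (completeLie act).smul_mem c hx
  | lie x y _ _ hx hy => rw [conjDer_lie]; exact LieSubalgebra.lie_mem _ hx hy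

theorem conjDer_mem_completeCore {α : A ≃ₐ[ℂ] A} (hα : ∀ γ a, act γ (α a) = α (act γ a))
    {d : Derivation ℂ A A} (hd : d ∈ completeCore act) : conjDer α d ∈ completeCore act := by
  intro c hc
  have h : c • conjDer α d = conjDer α (α.symm c • d) := by
    rw [conjDer_smul]; simp
  rw [h]
  refine conjDer_mem_completeLie hα (hd _ fun γ => α.injective ?_)
  rw [← hα]; simp [hc]

/-- The tangent vectors at `p` which are values of fields in `completeCore act`. -/
def coreTangent (act : Γ →* (A ≃ₐ[ℂ] A)) (p : A →ₐ[ℂ] ℂ) : Submodule ℂ (A →ₗ[ℂ] ℂ) where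
  carrier := {u | ∃ d ∈ completeCore act, fieldAt p d = u}
  add_mem' := by
    rintro _ _ ⟨d, hd, rfl⟩ ⟨e, he, rfl⟩
    exact ⟨d + e, add_mem hd he, by ext a; simp⟩
  zero_mem' := ⟨0, zero_mem _, by ext a; simp⟩
  smul_mem' := by
    rintro c _ ⟨d, hd, rfl⟩
    exact ⟨c • d, Submodule.smul_mem _ c hd, by ext a; simp⟩

theorem comp_mem_coreTangent {α : A ≃ₐ[ℂ] A} (hα : ∀ γ a, act γ (α a) = α (act γ a))
    {p : A →ₐ[ℂ] ℂ} {u : A →ₗ[ℂ] ℂ} (hu : u ∈ coreTangent act p) :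
    u ∘ₗ α.toLinearMap ∈ coreTangent act (p.comp α.toAlgHom) := by
  obtain ⟨d, hd, rfl⟩ := hu
  have hα' : ∀ γ a, act γ (α.symm a) = α.symm (act γ a) := by
    intro γ a
    apply α.injective
    rw [← hα]; simp
  refine ⟨conjDer α.symm d, conjDer_mem_completeCore hα' hd, ?_⟩
  ext a
  simp

theorem comp_mem_coreTangent_iff {α : A ≃ₐ[ℂ] A} (hα : ∀ γ a, act γ (α a) = α (act γ a))
    {p : A →ₐ[ℂ] ℂ} {u : A →ₗ[ℂ] ℂ} :
    u ∘ₗ α.toLinearMap ∈ coreTangent act (p.comp α.toAlgHom) ↔ u ∈ coreTangent act p := by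
  refine ⟨fun h => ?_, comp_mem_coreTangent hα⟩
  have hα' : ∀ γ a, act γ (α.symm a) = α.symm (act γ a) := by
    intro γ a
    apply α.injective
    rw [← hα]; simp
  have h1 := comp_mem_coreTangent hα' h
  have h2 : (p.comp α.toAlgHom).comp α.symm.toAlgHom = p := by ext a; simp
  have h3 : (u ∘ₗ α.toLinearMap) ∘ₗ α.symm.toLinearMap = u := by ext a; simp
  rwa [h2, h3] at h1

/-- If a field `e` lies in the Lie algebra together with `a • e`, where `a` is invariant under
`e`, then `d a • e` belongs to the core for every `d` in the core. -/
theorem apply_smul_mem_completeCore {d e : Derivation ℂ A A} {a : A}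
    (ha : ∀ γ, act γ a = a) (hd : d ∈ completeCore act) (he : e ∈ completeLie act)
    (hae : a • e ∈ completeLie act) : d a • e ∈ completeCore act := by
  have h : d a • e = a • ⁅e, d⁆ - ⁅a • e, d⁆ := by
    ext b
    simp [Derivation.commutator_apply]
    ring
  rw [h]
  exact sub_mem (smul_mem_completeCore (lie_mem_completeCore he hd) ha)
    (lie_mem_completeCore hae hd)

/-- The sum of the translates of a function under a finite group. -/
def groupTrace [Fintype Γ] (act : Γ →* (A ≃ₐ[ℂ] A)) (a : A) : A := ∑ γ, act γ a

theorem act_groupTrace [Fintype Γ] (a : A) (σ : Γ) :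
    act σ (groupTrace act a) = groupTrace act a := by
  rw [groupTrace, map_sum]
  refine Fintype.sum_equiv (Equiv.mulLeft σ) _ _ fun γ => ?_
  simp

theorem groupTrace_add [Fintype Γ] (a b : A) :
    groupTrace act (a + b) = groupTrace act a + groupTrace act b := by
  simp [groupTrace, Finset.sum_add_distrib]

theorem groupTrace_mul [Fintype Γ] {c : A} (hc : ∀ γ, act γ c = c) (a : A) :
    groupTrace act (c * a) = c * groupTrace act a := by
  simp [groupTrace, hc, Finset.mul_sum]

theorem groupTrace_of_invariant [Fintype Γ] {c : A} (hc : ∀ γ, act γ c = c) :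
    groupTrace act c = (Fintype.card Γ : ℂ) • c := by
  simp [groupTrace, hc, Nat.cast_smul_eq_nsmul]

/-- If the fields in the core span all tangent spaces of a smooth affine Γ-variety, then the
variety has the Γ-algebraic density property. -/
theorem completeLie_eq_of_coreTangent [Finite Γ] (hA : Algebra.FiniteType ℂ A)
    (hs : Algebra.FormallySmooth ℂ A)
    (h : ∀ p : A →ₐ[ℂ] ℂ, pointDerivations p ≤ coreTangent act p) :
    (completeLie act : Set (Derivation ℂ A A)) = {ζ | GammaInvField act ζ} := by
  cases nonempty_fintype Γ
  refine Set.Subset.antisymm (fun ζ hζ => GammaInvField.of_mem_completeLie hζ) fun ζ hζ => ?_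
  have htop := submodule_eq_top_of_span_tangent hA hs
    (Submodule.span A (completeCore act : Set (Derivation ℂ A A))) (by
      intro p u hu
      obtain ⟨d, hd, hdu⟩ := h p hu
      exact ⟨d, Submodule.subset_span hd, hdu⟩)
  have key : ∀ d : Derivation ℂ A A, ∀ f : A,
      ∑ γ, conjDer (act γ) (f • d) ∈ completeLie act := by
    intro d
    have hd : d ∈ Submodule.span A (completeCore act : Set (Derivation ℂ A A)) := by
      rw [htop]; trivial
    induction hd using Submodule.span_induction with
    | mem x hx =>
      intro f
      have : ∑ γ, conjDer (act γ) (f • x) = groupTrace act f • x := by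
        rw [groupTrace, Finset.sum_smul]
        refine Finset.sum_congr rfl fun γ _ => ?_
        rw [conjDer_smul]
        congr 1
        ext a
        rw [conjDer_apply, GammaInvField.of_mem_completeLie (completeCore_le hx)]
        simp
      rw [this]
      exact hx _ (act_groupTrace f)
    | zero => intro f; simp
    | add x y _ _ hx hy =>
      intro f
      simp only [smul_add, map_add, Finset.sum_add_distrib]
      exact add_mem (hx f) (hy f)
    | smul a x _ hx => intro f; rw [smul_smul]; exact hx _
  have h1 := key ζ 1
  have h2 : ∑ γ, conjDer (act γ) ((1 : A) • ζ) = (Fintype.card Γ : ℂ) • ζ := by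
    rw [one_smul]
    have : ∀ γ, conjDer (act γ) ζ = ζ := by
      intro γ
      ext a
      rw [conjDer_apply, hζ γ]
      simp
    simp [this, Nat.cast_smul_eq_nsmul]
  rw [h2] at h1
  have h3 := (completeLie act).smul_mem (Fintype.card Γ : ℂ)⁻¹ h1
  rwa [inv_smul_smul₀ (by simp)] at h3

end GammaFields

section Galois

variable {A : Type*} [CommRing A] [Algebra ℂ A] {Γ : Type*} [Group Γ]
  {act : Γ →* (A ≃ₐ[ℂ] A)} {ξ : Derivation ℂ A A}

theorem mem_invariantSubalgebra {a : A} : a ∈ invariantSubalgebra act ↔ ∀ γ, act γ a = a := by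
  simp [invariantSubalgebra, AlgHom.mem_equalizer]

/-- An element of a finite group acting trivially on the kernel of an invariant locally nilpotent
field acts trivially. -/
theorem act_eq_one_of_forall_kernel [IsDomain A] [Finite Γ] (hinv : GammaInvField act ξ)
    (hlnd : IsLND ξ) {γ : Γ} (hγ : ∀ k, ξ k = 0 → act γ k = k) : act γ = 1 := by
  have key : ∀ N : ℕ, ∀ b : A, (ξ.toLinearMap ^ N) b = 0 → act γ b = b := by
    intro N
    induction N with
    | zero => intro b hb; have : b = 0 := by simpa using hb
              simp [this]
    | succ N ih =>
      intro b hb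
      rw [pow_succ] at hb
      have h1 : act γ (ξ b) = ξ b := ih (ξ b) hb
      have h2 : act γ (act γ b - b) = act γ b - b := hγ _ (by rw [map_sub, ← hinv, h1, sub_self])
      have h3 : ∀ n : ℕ, act (γ ^ n) b = b + n * (act γ b - b) := by
        intro n
        induction n with
        | zero => simp
        | succ n ihn =>
          rw [pow_succ', map_mul, AlgEquiv.mul_apply, ihn, map_add, map_mul, h2]
          simp only [map_natCast, Nat.cast_succ]
          ring
      have h4 := h3 (orderOf γ)
      rw [pow_orderOf_eq_one, map_one, AlgEquiv.one_apply, left_eq_add, mul_eq_zero] at h4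
      have : CharZero A := charZero_of_injective_algebraMap (algebraMap ℂ A).injective
      rcases h4 with h4 | h4
      · exact absurd (Nat.cast_eq_zero.1 h4) (orderOf_pos γ).ne'
      · exact sub_eq_zero.1 h4
  ext b
  obtain ⟨N, hN⟩ := hlnd b
  exact key N b hN

/-- The span of the functions `γ ↦ k * γ l` on the group, with `k` and `l` in the kernel of `ξ`. -/
def kernelFunctions (act : Γ →* (A ≃ₐ[ℂ] A)) (ξ : Derivation ℂ A A) : Submodule ℂ (Γ → A) :=
  Submodule.span ℂ {F | ∃ k l : A, ξ k = 0 ∧ ξ l = 0 ∧ F = fun γ => k * act γ l}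

theorem mul_mem_kernelFunctions {F F' : Γ → A} (hF : F ∈ kernelFunctions act ξ)
    (hF' : F' ∈ kernelFunctions act ξ) : F * F' ∈ kernelFunctions act ξ := by
  have h := Submodule.mul_mem_mul hF hF'
  rw [kernelFunctions, Submodule.span_mul_span] at h
  refine Submodule.span_mono ?_ h
  rintro _ ⟨_, ⟨k, l, hk, hl, rfl⟩, _, ⟨k', l', hk', hl', rfl⟩, rfl⟩
  refine ⟨k * k', l * l', by simp [hk, hk'], by simp [hl, hl'], ?_⟩
  ext γ
  simp only [Pi.mul_apply, map_mul]
  ring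

theorem const_mem_kernelFunctions {k : A} (hk : ξ k = 0) :
    (fun _ => k) ∈ kernelFunctions act ξ :=
  Submodule.subset_span ⟨k, 1, hk, by simp, by simp⟩

theorem orbit_mem_kernelFunctions {k : A} (hk : ξ k = 0) :
    (fun γ => act γ k) ∈ kernelFunctions act ξ :=
  Submodule.subset_span ⟨1, k, by simp, hk, by simp⟩

theorem exists_single_mem_kernelFunctions [IsDomain A] [Finite Γ] [DecidableEq Γ]
    (heff : Function.Injective act) (hinv : GammaInvField act ξ) (hlnd : IsLND ξ) :
    ∃ h : A, h ≠ 0 ∧ (∀ γ, act γ h = h) ∧ Pi.single 1 h ∈ kernelFunctions act ξ := by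
  cases nonempty_fintype Γ
  have hex : ∀ σ : Γ, ∃ e : A, ξ e = 0 ∧ (σ ≠ 1 → act σ e ≠ e) := by
    intro σ
    by_contra! hcon
    have hσ : σ ≠ 1 := (hcon 0 (by simp)).1
    exact hσ (heff (by
      rw [act_eq_one_of_forall_kernel hinv hlnd fun k hk => (hcon k hk).2, map_one]))
  choose e he hne using hex
  have hact : ∀ (σ : Γ) (k : A), ξ k = 0 → ξ (act σ k) = 0 := fun σ k hk => by
    rw [← hinv, hk, map_zero]
  have hprod : ∀ s : Finset Γ, ∀ f : Γ → Γ → A, (∀ σ ∈ s, f σ ∈ kernelFunctions act ξ) →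
      ∏ σ ∈ s, f σ ∈ kernelFunctions act ξ := by
    intro s f hf
    refine Finset.prod_induction f (· ∈ kernelFunctions act ξ)
      (fun _ _ => mul_mem_kernelFunctions) (const_mem_kernelFunctions ξ.map_one_eq_zero) hf
  set F : Γ → A := ∏ σ ∈ Finset.univ.erase 1, ((fun _ => act σ (e σ)) - fun γ => act γ (e σ))
    with hFdef
  have hF : F ∈ kernelFunctions act ξ := hprod _ _ fun σ _ =>
    sub_mem (const_mem_kernelFunctions (hact _ _ (he σ))) (orbit_mem_kernelFunctions (he σ))
  have hF1 : F 1 ≠ 0 := by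
    rw [hFdef, Finset.prod_apply, Finset.prod_ne_zero_iff]
    intro σ hσ
    simpa [sub_eq_zero] using hne σ (Finset.ne_of_mem_erase hσ)
  have hFγ : ∀ γ, γ ≠ 1 → F γ = 0 := by
    intro γ hγ
    rw [hFdef, Finset.prod_apply]
    exact Finset.prod_eq_zero (Finset.mem_erase.2 ⟨hγ, Finset.mem_univ γ⟩) (by simp)
  have hker : ξ (F 1) = 0 := by
    rw [hFdef, Finset.prod_apply]
    refine Finset.prod_induction _ (fun a => ξ a = 0) (fun a b ha hb => by simp [ha, hb])
      (by simp) fun σ _ => ?_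
    simp [hact _ _ (he σ), he σ]
  refine ⟨∏ σ, act σ (F 1), ?_, fun γ => ?_, ?_⟩
  · exact Finset.prod_ne_zero_iff.2 fun σ _ => by simpa using hF1
  · rw [map_prod]
    refine Fintype.prod_equiv (Equiv.mulLeft γ) _ _ fun σ => ?_
    simp
  · have h1 := mul_mem_kernelFunctions hF (hprod (Finset.univ.erase 1)
      (fun σ _ => act σ (F 1)) fun σ _ => const_mem_kernelFunctions (hact _ _ hker))
    convert h1 using 1
    ext γ
    by_cases hγ : γ = 1
    · subst hγ
      rw [Pi.single_eq_same, Pi.mul_apply, Finset.prod_apply,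
        ← Finset.mul_prod_erase _ _ (Finset.mem_univ (1 : Γ))]
      simp
    · rw [Pi.single_eq_of_ne hγ, Pi.mul_apply, hFγ γ hγ, zero_mul]

end Galois

section Product

variable {AX AY : Type*} [CommRing AX] [Algebra ℂ AX] [CommRing AY] [Algebra ℂ AY]
  {Γ : Type*} [Group Γ]

/-- The product action of Γ. -/
def prodAct (actX : Γ →* (AX ≃ₐ[ℂ] AX)) (actY : Γ →* (AY ≃ₐ[ℂ] AY)) :
    Γ →* ((AX ⊗[ℂ] AY) ≃ₐ[ℂ] (AX ⊗[ℂ] AY)) where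
  toFun γ := Algebra.TensorProduct.congr (actX γ) (actY γ)
  map_one' := by
    ext w
    induction w with
    | zero => simp
    | tmul a b => simp
    | add u v hu hv => rw [map_add, hu, hv, map_add]
  map_mul' γ σ := by
    ext w
    induction w with
    | zero => simp
    | tmul a b => simp
    | add u v hu hv => rw [map_add, hu, hv, map_add]

variable {actX : Γ →* (AX ≃ₐ[ℂ] AX)} {actY : Γ →* (AY ≃ₐ[ℂ] AY)}

@[simp] theorem prodAct_tmul (γ : Γ) (a : AX) (b : AY) :
    prodAct actX actY γ (a ⊗ₜ b) = actX γ a ⊗ₜ actY γ b := rfl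

theorem derivation_leibniz_of_tmul (D : AX ⊗[ℂ] AY →ₗ[ℂ] AX ⊗[ℂ] AY)
    (h : ∀ a b c d, D ((a * c) ⊗ₜ (b * d)) =
      (a ⊗ₜ b) * D (c ⊗ₜ d) + (c ⊗ₜ d) * D (a ⊗ₜ b)) (u v : AX ⊗[ℂ] AY) :
    D (u * v) = u • D v + v • D u := by
  simp only [smul_eq_mul]
  induction u with
  | zero => simp
  | add u u' hu hu' => rw [add_mul, map_add, hu, hu', map_add]; ring
  | tmul a b =>
    induction v with
    | zero => simp
    | add v v' hv hv' => rw [mul_add, map_add, hv, hv', map_add]; ring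
    | tmul c d => rw [Algebra.TensorProduct.tmul_mul_tmul, h]

/-- The lift of a vector field on the first factor to the product. -/
def liftLeft (AY : Type*) [CommRing AY] [Algebra ℂ AY] (ξ : Derivation ℂ AX AX) :
    Derivation ℂ (AX ⊗[ℂ] AY) (AX ⊗[ℂ] AY) :=
  Derivation.mk' (ξ.toLinearMap.rTensor AY) (derivation_leibniz_of_tmul _ (by
    intro a b c d
    simp [TensorProduct.add_tmul, mul_comm d b]))

/-- The lift of a vector field on the second factor to the product. -/
def liftRight (AX : Type*) [CommRing AX] [Algebra ℂ AX] (ν : Derivation ℂ AY AY) :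
    Derivation ℂ (AX ⊗[ℂ] AY) (AX ⊗[ℂ] AY) :=
  Derivation.mk' (ν.toLinearMap.lTensor AX) (derivation_leibniz_of_tmul _ (by
    intro a b c d
    simp [TensorProduct.tmul_add, mul_comm c a]))

@[simp] theorem liftLeft_tmul (ξ : Derivation ℂ AX AX) (a : AX) (b : AY) :
    liftLeft AY ξ (a ⊗ₜ b) = ξ a ⊗ₜ b := rfl

@[simp] theorem liftRight_tmul (ν : Derivation ℂ AY AY) (a : AX) (b : AY) :
    liftRight AX ν (a ⊗ₜ b) = a ⊗ₜ ν b := rfl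

theorem GammaInvField.liftLeft {ξ : Derivation ℂ AX AX} (h : GammaInvField actX ξ) :
    GammaInvField (prodAct actX actY) (liftLeft AY ξ) := by
  intro γ w
  induction w with
  | zero => simp
  | tmul a b => simp [h γ a]
  | add u v hu hv => simp only [map_add, hu, hv]

theorem GammaInvField.liftRight {ν : Derivation ℂ AY AY} (h : GammaInvField actY ν) :
    GammaInvField (prodAct actX actY) (liftRight AX ν) := by
  intro γ w
  induction w with
  | zero => simp
  | tmul a b => simp [h γ b]
  | add u v hu hv => simp only [map_add, hu, hv]

theorem eq_productMap (p : AX ⊗[ℂ] AY →ₐ[ℂ] ℂ) : p = Algebra.TensorProduct.productMap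
    (p.comp Algebra.TensorProduct.includeLeft) (p.comp Algebra.TensorProduct.includeRight) := by
  ext a
  · simp
  · simp [← Algebra.TensorProduct.one_def]

theorem IsCompleteField.liftLeft {ξ : Derivation ℂ AX AX} (h : IsCompleteField ξ) :
    IsCompleteField (liftLeft AY ξ) := by
  intro p
  obtain ⟨γ, hγ0, hγ⟩ := h (p.comp Algebra.TensorProduct.includeLeft)
  refine ⟨fun t => Algebra.TensorProduct.productMap (γ t)
    (p.comp Algebra.TensorProduct.includeRight), ?_, fun w t => ?_⟩
  · simp only [hγ0]
    exact (eq_productMap p).symm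
  · induction w with
    | zero => simpa using hasDerivAt_const t (0 : ℂ)
    | tmul a b => simpa using (hγ a t).mul_const (p (1 ⊗ₜ b))
    | add u v hu hv => simp only [map_add]; exact hu.add hv

theorem IsCompleteField.liftRight {ν : Derivation ℂ AY AY} (h : IsCompleteField ν) :
    IsCompleteField (liftRight AX ν) := by
  intro p
  obtain ⟨γ, hγ0, hγ⟩ := h (p.comp Algebra.TensorProduct.includeRight)
  refine ⟨fun t => Algebra.TensorProduct.productMap
    (p.comp Algebra.TensorProduct.includeLeft) (γ t), ?_, fun w t => ?_⟩
  · simp only [hγ0]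
    exact (eq_productMap p).symm
  · induction w with
    | zero => simpa using hasDerivAt_const t (0 : ℂ)
    | tmul a b => simpa using (hγ b t).const_mul (p (a ⊗ₜ 1))
    | add u v hu hv => simp only [map_add]; exact hu.add hv

/-- The functional on the product given by functionals on the factors. -/
def prodFun : (AX →ₗ[ℂ] ℂ) →ₗ[ℂ] (AY →ₗ[ℂ] ℂ) →ₗ[ℂ] (AX ⊗[ℂ] AY →ₗ[ℂ] ℂ) :=
  LinearMap.mk₂ ℂ (fun u v => LinearMap.mul' ℂ ℂ ∘ₗ TensorProduct.map u v)
    (fun u u' v => by rw [TensorProduct.map_add_left, LinearMap.comp_add])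
    (fun c u v => by rw [TensorProduct.map_smul_left, LinearMap.comp_smul])
    (fun u v v' => by rw [TensorProduct.map_add_right, LinearMap.comp_add])
    (fun c u v => by rw [TensorProduct.map_smul_right, LinearMap.comp_smul])

@[simp] theorem prodFun_tmul (u : AX →ₗ[ℂ] ℂ) (v : AY →ₗ[ℂ] ℂ) (a : AX) (b : AY) :
    prodFun u v (a ⊗ₜ b) = u a * v b := by
  simp [prodFun]

theorem fieldAt_liftLeft (x : AX →ₐ[ℂ] ℂ) (y : AY →ₐ[ℂ] ℂ) (ξ : Derivation ℂ AX AX) :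
    fieldAt (Algebra.TensorProduct.productMap x y) (liftLeft AY ξ) =
      prodFun (fieldAt x ξ) y.toLinearMap := by
  ext a b; simp

theorem fieldAt_liftRight (x : AX →ₐ[ℂ] ℂ) (y : AY →ₐ[ℂ] ℂ) (ν : Derivation ℂ AY AY) :
    fieldAt (Algebra.TensorProduct.productMap x y) (liftRight AX ν) =
      prodFun x.toLinearMap (fieldAt y ν) := by
  ext a b; simp

/-- A tangent vector of a product is the sum of its components. -/
theorem eq_add_prodFun {x : AX →ₐ[ℂ] ℂ} {y : AY →ₐ[ℂ] ℂ} {v : AX ⊗[ℂ] AY →ₗ[ℂ] ℂ}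
    (hv : v ∈ pointDerivations (Algebra.TensorProduct.productMap x y)) :
    ∃ u₁ ∈ pointDerivations x, ∃ u₂ ∈ pointDerivations y,
      v = prodFun u₁ y.toLinearMap + prodFun x.toLinearMap u₂ := by
  refine ⟨v ∘ₗ (Algebra.TensorProduct.includeLeft (S := ℂ)).toLinearMap, fun a b => ?_,
    v ∘ₗ Algebra.TensorProduct.includeRight.toLinearMap, fun a b => ?_, ?_⟩
  · simpa using hv (a ⊗ₜ 1) (b ⊗ₜ 1)
  · simpa using hv (1 ⊗ₜ a) (1 ⊗ₜ b)
  · ext a b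
    have := hv (a ⊗ₜ 1) (1 ⊗ₜ b)
    simp only [Algebra.TensorProduct.tmul_mul_tmul, mul_one, one_mul] at this
    simp [this]
    ring

/-- The automorphism of the product induced by an automorphism of the first factor. -/
def leftAut (AY : Type*) [CommRing AY] [Algebra ℂ AY] (α : AX ≃ₐ[ℂ] AX) :
    (AX ⊗[ℂ] AY) ≃ₐ[ℂ] (AX ⊗[ℂ] AY) :=
  Algebra.TensorProduct.congr α AlgEquiv.refl

@[simp] theorem leftAut_tmul (α : AX ≃ₐ[ℂ] AX) (a : AX) (b : AY) :
    leftAut AY α (a ⊗ₜ b) = α a ⊗ₜ b := rfl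

theorem leftAut_comm {α : AX ≃ₐ[ℂ] AX} (hα : ∀ γ a, actX γ (α a) = α (actX γ a)) (γ : Γ)
    (w : AX ⊗[ℂ] AY) :
    prodAct actX actY γ (leftAut AY α w) = leftAut AY α (prodAct actX actY γ w) := by
  induction w with
  | zero => simp
  | tmul a b => simp [hα]
  | add u v hu hv => simp only [map_add, hu, hv]

theorem productMap_comp_leftAut (x : AX →ₐ[ℂ] ℂ) (y : AY →ₐ[ℂ] ℂ) (α : AX ≃ₐ[ℂ] AX) :
    (Algebra.TensorProduct.productMap x y).comp (leftAut AY α).toAlgHom =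
      Algebra.TensorProduct.productMap (x.comp α.toAlgHom) y := by
  ext a <;> simp

theorem prodFun_comp_leftAut (u : AX →ₗ[ℂ] ℂ) (v : AY →ₗ[ℂ] ℂ) (α : AX ≃ₐ[ℂ] AX) :
    prodFun u v ∘ₗ (leftAut AY α).toLinearMap = prodFun (u ∘ₗ α.toLinearMap) v := by
  ext a b; simp

theorem prodFun_comp_mem_coreTangent_iff {α : AX ≃ₐ[ℂ] AX}
    (hα : ∀ γ a, actX γ (α a) = α (actX γ a)) (x : AX →ₐ[ℂ] ℂ) (y : AY →ₐ[ℂ] ℂ)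
    (u : AX →ₗ[ℂ] ℂ) (v : AY →ₗ[ℂ] ℂ) :
    prodFun (u ∘ₗ α.toLinearMap) v ∈ coreTangent (prodAct actX actY)
        (Algebra.TensorProduct.productMap (x.comp α.toAlgHom) y) ↔
      prodFun u v ∈ coreTangent (prodAct actX actY)
        (Algebra.TensorProduct.productMap x y) := by
  rw [← productMap_comp_leftAut, ← prodFun_comp_leftAut]
  exact comp_mem_coreTangent_iff (leftAut_comm hα)

theorem comp_mem_pointDerivations {A : Type*} [CommRing A] [Algebra ℂ A] {p : A →ₐ[ℂ] ℂ}
    {u : A →ₗ[ℂ] ℂ} (hu : u ∈ pointDerivations p) (α : A ≃ₐ[ℂ] A) :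
    u ∘ₗ α.toLinearMap ∈ pointDerivations (p.comp α.toAlgHom) := by
  intro a b
  simpa using hu (α a) (α b)

theorem smul_mem_completeLie_of_compatible {A : Type*} [CommRing A] [Algebra ℂ A]
    {act : Γ →* (A ≃ₐ[ℂ] A)} {ξ η : Derivation ℂ A A} (hξ : IsCompleteField ξ)
    (hη : IsCompleteField η) (hξi : GammaInvField act ξ) (hηi : GammaInvField act η)
    {t g a : A} (ht : ξ t = 0) (hti : ∀ γ, act γ t = t) (hg : η g = 0)
    (hgi : ∀ γ, act γ g = g) (ha : η a = 0) (hai : ∀ γ, act γ a = a) (haa : ξ (ξ a) = 0) :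
    (t * g * ξ a) • η ∈ completeLie act := by
  have h1 : (t * a) • ξ ∈ completeLie act :=
    mem_completeLie (hξ.smul (by simp [ht, haa])) (hξi.smul fun γ => by simp [hti, hai])
  have h2 : g • η ∈ completeLie act :=
    mem_completeLie (hη.smul (by simp [hg])) (hηi.smul hgi)
  have h3 : t • ξ ∈ completeLie act :=
    mem_completeLie (hξ.smul (by simp [ht])) (hξi.smul hti)
  have h4 : (a * g) • η ∈ completeLie act :=
    mem_completeLie (hη.smul (by simp [hg, ha])) (hηi.smul fun γ => by simp [hgi, hai])
  have h : (t * g * ξ a) • η = ⁅t • ξ, (a * g) • η⁆ - ⁅(t * a) • ξ, g • η⁆ := by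
    ext b
    simp [Derivation.commutator_apply, ha]
    ring
  rw [h]
  exact sub_mem (LieSubalgebra.lie_mem _ h3 h4) (LieSubalgebra.lie_mem _ h1 h2)

/-- A Γ-compatible pair on the first factor produces a nonzero multiple of `η` in the core of
the product. -/
theorem exists_smul_liftLeft_mem_completeCore [IsDomain AX] [Finite Γ]
    (heff : Function.Injective actX) {ξ η : Derivation ℂ AX AX}
    (hpair : GammaCompatiblePair actX ξ η) :
    ∃ j : AX, j ≠ 0 ∧ liftLeft AY (j • η) ∈ completeCore (prodAct actX actY) := by
  classical
  cases nonempty_fintype Γ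
  obtain ⟨hξ, hη, -, -, hξi, hηi, hlnd, ⟨I, hI, hspan⟩, a, ha, hai, ha0, haa⟩ := hpair
  obtain ⟨h, hh0, hhi, hsingle⟩ := exists_single_mem_kernelFunctions heff hξi hlnd
  obtain ⟨b, hbI, hb0⟩ := Submodule.exists_mem_ne_zero_of_ne_bot hI
  have hsemi : ∀ t : AX ⊗[ℂ] AY, liftLeft AY ξ t = 0 → (∀ γ, prodAct actX actY γ t = t) →
      ∀ c ∈ I, (t * (((c : AX) * ξ a) ⊗ₜ[ℂ] (1 : AY))) • liftLeft AY η ∈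
        completeLie (prodAct actX actY) := by
    intro t ht hti c hc
    have hc' := hspan c hc
    generalize (c : AX) = c' at hc' ⊢
    induction hc' using Submodule.span_induction with
    | mem w hw =>
      obtain ⟨f, g, hf, hfi, hg, hgi, rfl⟩ := hw
      have := smul_mem_completeLie_of_compatible (act := prodAct actX actY)
        (t := t * (f ⊗ₜ 1)) (g := g ⊗ₜ 1) (a := a ⊗ₜ 1)
        (hξ.liftLeft (AY := AY)) (hη.liftLeft (AY := AY)) hξi.liftLeft hηi.liftLeft
        (by simp [ht, hf]) (fun γ => by simp [hti, hfi]) (by simp [hg])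
        (fun γ => by simp [hgi]) (by simp [ha]) (fun γ => by simp [hai]) (by simp [haa])
      convert this using 2
      simp only [liftLeft_tmul, mul_assoc, Algebra.TensorProduct.tmul_mul_tmul, mul_one]
    | zero => simp
    | add u v _ _ hu hv =>
      rw [add_mul, TensorProduct.add_tmul, mul_add, add_smul]
      exact add_mem hu hv
    | smul r u _ hu =>
      rw [smul_mul_assoc, ← TensorProduct.smul_tmul', mul_smul_comm, smul_assoc]
      exact (completeLie _).smul_mem r hu
  have htrace : ∀ F ∈ kernelFunctions actX ξ, ∀ (z : AX) (y : AY),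
      (groupTrace (prodAct actX actY) ((∑ γ, F γ * actX γ z) ⊗ₜ[ℂ] y) *
        (((b : AX) * ξ a) ⊗ₜ[ℂ] (1 : AY))) • liftLeft AY η ∈
        completeLie (prodAct actX actY) := by
    intro F hF z y
    induction hF using Submodule.span_induction with
    | mem F hF =>
      obtain ⟨k, l, hk, hl, rfl⟩ := hF
      have hTi : ∀ γ, actX γ (groupTrace actX (l * z)) = groupTrace actX (l * z) :=
        act_groupTrace _
      have h1 : (∑ γ, k * actX γ l * actX γ z) ⊗ₜ[ℂ] y =
          (groupTrace actX (l * z) ⊗ₜ[ℂ] (1 : AY)) * (k ⊗ₜ[ℂ] y) := by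
        rw [Algebra.TensorProduct.tmul_mul_tmul, one_mul, groupTrace, Finset.sum_mul]
        congr 1
        refine Finset.sum_congr rfl fun γ _ => ?_
        rw [map_mul]; ring
      rw [h1, groupTrace_mul (fun γ => by rw [prodAct_tmul, hTi, map_one])]
      have h2 := hsemi (groupTrace (prodAct actX actY) (k ⊗ₜ[ℂ] y)) (by
          rw [groupTrace, map_sum]
          refine Finset.sum_eq_zero fun γ _ => ?_
          rw [← (hξi.liftLeft (AY := AY) (actY := actY)) γ]
          simp [hk]) (act_groupTrace _)
        (⟨groupTrace actX (l * z), mem_invariantSubalgebra.2 hTi⟩ * b) (I.mul_mem_left _ hbI)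
      convert h2 using 2
      rw [mul_comm (groupTrace actX (l * z) ⊗ₜ[ℂ] (1 : AY)), mul_assoc,
        Algebra.TensorProduct.tmul_mul_tmul]
      simp [mul_assoc]
    | zero => simp [groupTrace]
    | add F F' _ _ hF hF' =>
      simp only [Pi.add_apply, add_mul, Finset.sum_add_distrib, TensorProduct.add_tmul,
        groupTrace_add, add_smul]
      exact add_mem hF hF'
    | smul r F _ hF =>
      have h1 : groupTrace (prodAct actX actY) ((∑ γ, (r • F) γ * actX γ z) ⊗ₜ[ℂ] y) =
          r • groupTrace (prodAct actX actY) ((∑ γ, F γ * actX γ z) ⊗ₜ[ℂ] y) := by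
        simp only [Pi.smul_apply, smul_mul_assoc, ← Finset.smul_sum,
          ← TensorProduct.smul_tmul', groupTrace, map_smul]
      rw [h1, smul_mul_assoc, smul_assoc]
      exact (completeLie _).smul_mem r hF
  have hall : ∀ w : AX ⊗[ℂ] AY, (groupTrace (prodAct actX actY) w *
      ((h * ((b : AX) * ξ a)) ⊗ₜ[ℂ] (1 : AY))) • liftLeft AY η ∈
        completeLie (prodAct actX actY) := by
    intro w
    induction w with
    | zero => simp [groupTrace]
    | add u v hu hv => rw [groupTrace_add, add_mul, add_smul]; exact add_mem hu hv
    | tmul z y =>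
      convert htrace _ hsingle z y using 2
      have h1 : (∑ γ, (Pi.single 1 h : Γ → AX) γ * actX γ z) = h * z := by
        rw [Finset.sum_eq_single 1 (fun γ _ hγ => by rw [Pi.single_eq_of_ne hγ, zero_mul])
          (by simp)]
        simp
      have h2 : (h * z) ⊗ₜ[ℂ] y = (h ⊗ₜ[ℂ] (1 : AY)) * (z ⊗ₜ[ℂ] y) := by simp
      rw [h1, h2, groupTrace_mul (fun γ => by simp [hhi]),
        mul_comm (h ⊗ₜ[ℂ] (1 : AY)), mul_assoc, Algebra.TensorProduct.tmul_mul_tmul, one_mul]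
  refine ⟨h * ((b : AX) * ξ a), ?_, fun c hc => ?_⟩
  · exact mul_ne_zero hh0 (mul_ne_zero (fun hb => hb0 (Subtype.ext hb)) ha0)
  · have h1 : liftLeft AY ((h * ((b : AX) * ξ a)) • η) =
        ((h * ((b : AX) * ξ a)) ⊗ₜ[ℂ] (1 : AY)) • liftLeft AY η := by
      ext w
      induction w with
      | zero => simp
      | tmul a b => simp
      | add u v hu hv => rw [map_add, hu, hv, map_add]
    have h2 := (completeLie _).smul_mem (Fintype.card Γ : ℂ)⁻¹ (hall c)
    rwa [groupTrace_of_invariant hc, smul_mul_assoc, smul_assoc, inv_smul_smul₀ (by simp),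
      ← smul_smul, ← h1] at h2

end Product

theorem statement19 {n : ℕ} (G : Subgroup (GLn n))
    (hGclosed : IsZClosedInGL (G : Set (GLn n)))
    (AX AY : Type) [CommRing AX] [IsDomain AX] [Algebra ℂ AX]
    [CommRing AY] [IsDomain AY] [Algebra ℂ AY]
    (hfgX : Algebra.FiniteType ℂ AX) (hsmX : Algebra.FormallySmooth ℂ AX)
    (hfgY : Algebra.FiniteType ℂ AY) (hsmY : Algebra.FormallySmooth ℂ AY)
    (Γ : Type) [Group Γ] [Finite Γ]
    (actX : Γ →* (AX ≃ₐ[ℂ] AX)) (heffX : Function.Injective actX)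
    (actY : Γ →* (AY ≃ₐ[ℂ] AY))
    -- X is homogeneous under an algebraic G-action commuting with Γ
    (ρ : AlgebraicAction G AX) (htrans : ρ.Transitive)
    (hcomm : ∀ (γ : Γ) (g : ↥G) (a : AX), actX γ (ρ.act g a) = ρ.act g (actX γ a))
    -- the point x at which the isotropy group acts irreducibly on T_xX
    (x : AX →ₐ[ℂ] ℂ)
    (hirr : ∀ V : Submodule ℂ (AX →ₗ[ℂ] ℂ), V ≤ pointDerivations x →
      (∀ α : AX ≃ₐ[ℂ] AX, (∀ (γ : Γ) (a : AX), actX γ (α a) = α (actX γ a)) →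
        x.comp α.toAlgHom = x → ∀ u ∈ V, u.comp α.toLinearMap ∈ V) →
      V = ⊥ ∨ V = pointDerivations x)
    -- the Γ-compatible pair (ξ, η) with η(x) ≠ 0
    (ξ η : Derivation ℂ AX AX) (hpair : GammaCompatiblePair actX ξ η)
    (hηx : fieldAt x η ≠ 0)
    -- the values of the Γ-invariant complete fields on Y generate every T_yY
    (hY : ∀ (y : AY →ₐ[ℂ] ℂ) (u : AY →ₗ[ℂ] ℂ), u ∈ pointDerivations y →
      u ∈ Submodule.span ℂ {w : AY →ₗ[ℂ] ℂ | ∃ ν : Derivation ℂ AY AY,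
        IsCompleteField ν ∧ GammaInvField actY ν ∧ w = fieldAt y ν}) :
    -- conclusion: W = X × Y has Γ-ADP
    (LieSubalgebra.lieSpan ℂ (Derivation ℂ (AX ⊗[ℂ] AY) (AX ⊗[ℂ] AY))
        {ζ | IsCompleteField ζ ∧ ∀ (γ : Γ) (w : AX ⊗[ℂ] AY),
          (Algebra.TensorProduct.congr (actX γ) (actY γ)) (ζ w)
            = ζ ((Algebra.TensorProduct.congr (actX γ) (actY γ)) w)}
      : Set (Derivation ℂ (AX ⊗[ℂ] AY) (AX ⊗[ℂ] AY)))
    = {ζ : Derivation ℂ (AX ⊗[ℂ] AY) (AX ⊗[ℂ] AY) | ∀ (γ : Γ) (w : AX ⊗[ℂ] AY),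
        (Algebra.TensorProduct.congr (actX γ) (actY γ)) (ζ w)
          = ζ ((Algebra.TensorProduct.congr (actX γ) (actY γ)) w)} := by
  obtain ⟨j, hj, hcore⟩ := exists_smul_liftLeft_mem_completeCore (actY := actY) heffX hpair
  obtain ⟨hξ, hη, -, hη0, hξi, hηi, hlnd, -, a, ha, hai, ha0, haa⟩ := hpair
  obtain ⟨c, hc⟩ : ∃ c, η c ≠ 0 := by
    by_contra! h
    exact hη0 (by ext c; simpa using h c)
  obtain ⟨x₀, hx₀⟩ := exists_point_ne_zero hfgX (mul_ne_zero (mul_ne_zero hj ha0) hc)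
  rw [map_mul, map_mul, mul_ne_zero_iff, mul_ne_zero_iff] at hx₀
  obtain ⟨⟨hxj, hxa⟩, hxc⟩ := hx₀
  -- The tangent directions to `X` at the points over `x`.
  have hX : ∀ (y : AY →ₐ[ℂ] ℂ), ∀ u ∈ pointDerivations x, prodFun u y.toLinearMap ∈
      coreTangent (prodAct actX actY) (Algebra.TensorProduct.productMap x y) := by
    intro y
    have hV := hirr (pointDerivations x ⊓ (coreTangent (prodAct actX actY)
      (Algebra.TensorProduct.productMap x y)).comap
        ((LinearMap.flip prodFun) y.toLinearMap)) inf_le_left (by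
      rintro α hα hαx u ⟨hu, hu'⟩
      refine ⟨?_, ?_⟩
      · have := comp_mem_pointDerivations hu α
        rwa [hαx] at this
      · have := (prodFun_comp_mem_coreTangent_iff hα x y u y.toLinearMap).2 hu'
        rwa [hαx] at this)
    rcases hV with hV | hV
    · exfalso
      obtain ⟨g, rfl⟩ := htrans x₀ x
      have hmem : fieldAt x₀ (j • η) ∘ₗ (ρ.act g).toLinearMap ∈ (⊥ : Submodule ℂ _) := by
        rw [← hV]
        refine ⟨comp_mem_pointDerivations (fun a b => by simp) _, ?_⟩
        exact (prodFun_comp_mem_coreTangent_iff (fun γ a => hcomm γ g a) x₀ y _ _).2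
          ⟨_, hcore, fieldAt_liftLeft _ _ _⟩
      have := LinearMap.congr_fun ((Submodule.mem_bot ℂ).1 hmem) ((ρ.act g).symm c)
      simp [hxj, hxc] at this
    · intro u hu
      rw [← hV] at hu
      exact hu.2
  have hX' : ∀ (z : AX →ₐ[ℂ] ℂ) (y : AY →ₐ[ℂ] ℂ), ∀ u ∈ pointDerivations z,
      prodFun u y.toLinearMap ∈
        coreTangent (prodAct actX actY) (Algebra.TensorProduct.productMap z y) := by
    intro z y u hu
    obtain ⟨g, hg⟩ := htrans z x
    rw [← prodFun_comp_mem_coreTangent_iff (fun γ a => hcomm γ g a), ← hg]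
    refine hX y _ ?_
    rw [hg]
    exact comp_mem_pointDerivations hu _
  -- The tangent directions to `Y` at the points over `x₀`.
  have hYdir : ∀ (y : AY →ₐ[ℂ] ℂ), ∀ u ∈ pointDerivations y, prodFun x₀.toLinearMap u ∈
      coreTangent (prodAct actX actY) (Algebra.TensorProduct.productMap x₀ y) := by
    intro y u hu
    obtain ⟨d, hd, hdξ⟩ := hX' x₀ y (fieldAt x₀ ξ) (fun a b => by simp)
    have hda := LinearMap.congr_fun hdξ (a ⊗ₜ 1)
    rw [fieldAt_apply, prodFun_tmul, fieldAt_apply] at hda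
    have hspan := hY y u hu
    clear hu
    induction hspan using Submodule.span_induction with
    | mem w hw =>
      obtain ⟨ν, hν, hνi, rfl⟩ := hw
      have hai' : ∀ γ, prodAct actX actY γ (a ⊗ₜ 1) = a ⊗ₜ 1 := fun γ => by simp [hai]
      have h1 := apply_smul_mem_completeCore hai' hd
        (mem_completeLie hν.liftRight hνi.liftRight)
        (mem_completeLie (hν.liftRight.smul (by simp)) (hνi.liftRight.smul hai'))
      have h2 := (coreTangent (prodAct actX actY)
        (Algebra.TensorProduct.productMap x₀ y)).smul_mem (x₀ (ξ a))⁻¹ ⟨_, h1, rfl⟩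
      convert h2 using 1
      rw [← fieldAt_liftRight]
      ext b b'
      simp only [TensorProduct.AlgebraTensorModule.curry_apply, LinearMap.restrictScalars_self,
        TensorProduct.curry_apply, LinearMap.smul_apply, fieldAt_apply, Derivation.smul_apply,
        smul_eq_mul, map_mul, hda]
      simp [hxa]
    | zero => simp
    | add u v _ _ hu hv => rw [map_add]; exact add_mem hu hv
    | smul r u _ hu => rw [map_smul]; exact Submodule.smul_mem _ r hu
  refine completeLie_eq_of_coreTangent (act := prodAct actX actY)
    (hfgX.trans (inferInstanceAs (Algebra.FiniteType AX (AX ⊗[ℂ] AY))))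
    (Algebra.FormallySmooth.comp ℂ AX _) fun p => ?_
  rw [eq_productMap p]
  generalize p.comp Algebra.TensorProduct.includeLeft = z
  generalize p.comp Algebra.TensorProduct.includeRight = y
  intro v hv
  obtain ⟨g, hg⟩ := htrans z x₀
  obtain ⟨u₁, hu₁, u₂, hu₂, rfl⟩ := eq_add_prodFun hv
  refine add_mem (hX' z y u₁ hu₁) ?_
  rw [← prodFun_comp_mem_coreTangent_iff (fun γ a => hcomm γ g a), ← hg]
  have hz : z.toLinearMap ∘ₗ (ρ.act g).toLinearMap = x₀.toLinearMap := by
    rw [hg]; rfl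
  rw [hz]
  exact hYdir y u₂ hu₂
end
end
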